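/- Let q = p^r with p > 3 prime and q > 9887, and let E be an elliptic curve defined over F_q with j-invariant j(E) = 0 and with an even number of F_q-rational points. If r is even or p ≡ 1 (mod 3), then the 4-elliptic code associated to E is not 2-extendable. -/

import Mathlib

set_option linter.unusedSectionVars false

namespace NMDS

open WeierstrassCurve

variable {F : Type} [Field F] [Fintype F] [DecidableEq F]

/-- `ψ_i(X,Y)`: `Y^s` if `i = 3s` (`s ≥ 1`), `X·Y^s` if `i = 3s+2` (`s ≥ 0`),
`X²·Y^s` if `i = 3s+4` (`s ≥ 0`). -/
def psi (i : ℕ) (X Y : F) : F :=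
  if i % 3 = 0 then Y ^ (i / 3)
  else if i % 3 = 2 then X * Y ^ (i / 3)
  else X ^ 2 * Y ^ ((i - 4) / 3)

/-- The coordinate vector of `φ_k(P)`: `(1, ψ₂(P), …, ψ_k(P))` for an affine point `P`,
and `(0, …, 0, 1)` for the point at infinity. -/
def phiVec (W : WeierstrassCurve F) (k : ℕ) : W.toAffine.Point → (Fin k → F)
  | .zero => fun j => if (j : ℕ) = k - 1 then 1 else 0
  | .some (x := x) (y := y) _ => fun j => if (j : ℕ) = 0 then 1 else psi ((j : ℕ) + 1) x y

lemma phiVec_ne_zero (W : WeierstrassCurve F) {k : ℕ} (hk : 0 < k)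
    (P : W.toAffine.Point) : phiVec W k P ≠ 0 := by
  cases P with
  | zero =>
    intro h
    have := congrFun h ⟨k - 1, by omega⟩
    simp [phiVec] at this
  | some h' =>
    intro h
    have := congrFun h ⟨0, hk⟩
    simp [phiVec] at this

/-- The image of a rational point of `E` in `P^{k-1}(F_q)` under `φ_k`. -/
noncomputable def phiProj (W : WeierstrassCurve F) {k : ℕ} (hk : 0 < k)
    (P : W.toAffine.Point) : Projectivization F (Fin k → F) :=
  Projectivization.mk F (phiVec W k P) (phiVec_ne_zero W hk P)

/-- The `k`-elliptic code associated to `E`, relative to an enumeration `e` of the `n`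
rational points of `E`: the span of the rows of the `k × n` matrix whose `j`-th column
is `φ_k(P_j)`. -/
def ellipticCode (W : WeierstrassCurve F) (k : ℕ) {n : ℕ}
    (e : Fin n ≃ W.toAffine.Point) : Submodule F (Fin n → F) :=
  Submodule.span F (Set.range fun i : Fin k => fun j : Fin n => phiVec W k (e j) i)

/-- The minimum distance (= minimum weight) of a linear code. -/
noncomputable def minDist {n : ℕ} (C : Submodule F (Fin n → F)) : ℕ :=
  sInf {d | ∃ x ∈ C, x ≠ 0 ∧ hammingNorm x = d}

/-- The standard inner product with `y` as a linear map. -/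
def dotLin {n : ℕ} (y : Fin n → F) : (Fin n → F) →ₗ[F] F where
  toFun x := ∑ i, x i * y i
  map_add' a b := by simp [add_mul, Finset.sum_add_distrib]
  map_smul' c a := by simp [Finset.mul_sum, mul_assoc]

/-- The dual code: all vectors orthogonal to every codeword. -/
def dualCode {n : ℕ} (C : Submodule F (Fin n → F)) : Submodule F (Fin n → F) :=
  ⨅ y ∈ C, LinearMap.ker (dotLin y)

/-- The Singleton defect `s(C) = n - k + 1 - d` of a code of length `n`. -/
noncomputable def singletonDefect {n : ℕ} (C : Submodule F (Fin n → F)) : ℤ :=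
  (n : ℤ) + 1 - Module.finrank F C - minDist C

/-- A code is MDS if its Singleton defect is zero. -/
noncomputable def IsMDS {n : ℕ} (C : Submodule F (Fin n → F)) : Prop :=
  singletonDefect C = 0

/-- A code is near-MDS if both it and its dual have Singleton defect one. -/
noncomputable def IsNMDS {n : ℕ} (C : Submodule F (Fin n → F)) : Prop :=
  singletonDefect C = 1 ∧ singletonDefect (dualCode C) = 1

/-- An `[n,k,d]_q` code `C` is `h`-extendable if there is an `[n+h,k,d+h]_q` code `C'`
whose projection on the first `n` coordinates is `C`. -/
noncomputable def IsHExtendable {n : ℕ} (h : ℕ) (C : Submodule F (Fin n → F)) : Prop :=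
  ∃ C' : Submodule F (Fin (n + h) → F),
    Module.finrank F C' = Module.finrank F C ∧
    minDist C' = minDist C + h ∧
    Submodule.map (LinearMap.funLeft F F (Fin.castAdd h)) C' = C

/-- The point `p` of `P^{k-1}(F_q)` lies on the hyperplane with coefficient vector `a`. -/
def OnHyp {k : ℕ} (a : Fin k → F) (p : Projectivization F (Fin k → F)) : Prop :=
  ∑ i, a i * p.rep i = 0

/-- An `(·; k, k-2)`-set in `P^{k-1}(F_q)`: no `k+1` of its points lie on a common hyperplane,
i.e. every hyperplane contains at most `k` of its points. -/
def IsArcSet (k : ℕ) (S : Set (Projectivization F (Fin k → F))) : Prop :=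
  ∀ a : Fin k → F, a ≠ 0 → Set.ncard {p ∈ S | OnHyp a p} ≤ k

/-- A complete `(·; k, k-2)`-set: maximal with respect to set-theoretical inclusion. -/
def IsCompleteArcSet (k : ℕ) (S : Set (Projectivization F (Fin k → F))) : Prop :=
  IsArcSet k S ∧ ∀ T, IsArcSet k T → S ⊆ T → T = S

/-- Evaluation of the homogeneous cubic of a Weierstrass curve:
`Y²Z + a₁XYZ + a₃YZ² - X³ - a₂X²Z - a₄XZ² - a₆Z³`. -/
def cubicEval {R : Type*} [CommRing R] (W : WeierstrassCurve R) (x y z : R) : R :=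
  y ^ 2 * z + W.a₁ * x * y * z + W.a₃ * y * z ^ 2
    - (x ^ 3 + W.a₂ * x ^ 2 * z + W.a₄ * x * z ^ 2 + W.a₆ * z ^ 3)

/-- The gradient of the homogeneous cubic of a Weierstrass curve. -/
def gradEval {R : Type*} [CommRing R] (W : WeierstrassCurve R) (x y z : R) : Fin 3 → R :=
  ![W.a₁ * y * z - (3 * x ^ 2 + 2 * W.a₂ * x * z + W.a₄ * z ^ 2),
    2 * y * z + W.a₁ * x * z + W.a₃ * z ^ 2,
    y ^ 2 + W.a₁ * x * y + 2 * W.a₃ * y * z - (W.a₂ * x ^ 2 + 2 * W.a₄ * x * z + 3 * W.a₆ * z ^ 2)]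

/-- The point `p` of `P²(F_q)` lies on the plane cubic `E`. -/
def OnCurve (W : WeierstrassCurve F) (p : Projectivization F (Fin 3 → F)) : Prop :=
  cubicEval W (p.rep 0) (p.rep 1) (p.rep 2) = 0

/-- A line of `P²(F_q)`, given by its coefficient vector `l`, is a tangent of `E`:
it touches the curve at some point (over the algebraic closure) with multiplicity at
least two, i.e. it is the tangent line of the cubic at a contact point. -/
def IsTangentLine (W : WeierstrassCurve F) (l : Fin 3 → F) : Prop :=
  ∃ v : Fin 3 → AlgebraicClosure F, v ≠ 0 ∧
    cubicEval (W.baseChange (AlgebraicClosure F)) (v 0) (v 1) (v 2) = 0 ∧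
    (∑ i, algebraMap F (AlgebraicClosure F) (l i) * v i) = 0 ∧
    ∃ t : AlgebraicClosure F, t ≠ 0 ∧
      gradEval (W.baseChange (AlgebraicClosure F)) (v 0) (v 1) (v 2) =
        t • fun i => algebraMap F (AlgebraicClosure F) (l i)

/-- A line of `P²(F_q)` intersects `E` in three distinct `F_q`-rational points. -/
def IsThreeSecant (W : WeierstrassCurve F) (l : Fin 3 → F) : Prop :=
  ∃ u v w : Projectivization F (Fin 3 → F), u ≠ v ∧ u ≠ w ∧ v ≠ w ∧
    OnCurve W u ∧ OnCurve W v ∧ OnCurve W w ∧ OnHyp l u ∧ OnHyp l v ∧ OnHyp l w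

section

open Polynomial

/-- `f` is not a constant times a square in the field of rational functions. -/
def NonSq (f : F[X]) : Prop :=
  ∀ (a b : F[X]) (c : F), a ^ 2 * f = C c * b ^ 2 → a = 0

lemma NonSq.ne_zero {f : F[X]} (hf : NonSq f) : f ≠ 0 := by
  rintro rfl
  exact one_ne_zero (hf 1 0 0 (by simp))

lemma NonSq.taylor {f : F[X]} (hf : NonSq f) (r : F) : NonSq (Polynomial.taylor r f) := by
  intro a b c h
  have h2 := congrArg (taylorAlgHom (-r)) h
  simp only [map_mul, map_pow, taylorAlgHom_apply, taylor_taylor, taylor_C] at h2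
  rw [neg_add_cancel, taylor_zero] at h2
  have := hf _ _ _ h2
  rwa [taylor_eq_zero] at this

/-- A polynomial with a simple root in an extension field is not a constant times a square. -/
lemma nonSq_of_simple_root {K : Type*} [Field K] [Algebra F K] {f : F[X]} (z : K)
    (hz : aeval z f = 0) (hz' : aeval z (derivative f) ≠ 0) : NonSq f := by
  intro a b c h
  by_contra ha
  have hf : f ≠ 0 := by rintro rfl; simp at hz'
  have hinj := FaithfulSMul.algebraMap_injective F K
  have hm : ∀ {g : F[X]}, g ≠ 0 → g.map (algebraMap F K) ≠ 0 := fun hg =>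
    (Polynomial.map_ne_zero_iff hinj).2 hg
  have hcb : C c * b ^ 2 ≠ 0 := by
    rw [← h]; exact mul_ne_zero (pow_ne_zero _ ha) hf
  have hc : c ≠ 0 := by rintro rfl; simp at hcb
  have hb : b ≠ 0 := by rintro rfl; simp at hcb
  have h2 := congrArg (Polynomial.map (algebraMap F K)) h
  simp only [Polynomial.map_mul, map_C, pow_two] at h2
  have h3 := congrArg (rootMultiplicity z) h2
  have hc' : (algebraMap F K) c ≠ 0 := by simpa using hc
  rw [rootMultiplicity_mul (mul_ne_zero (mul_ne_zero (hm ha) (hm ha)) (hm hf)),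
    rootMultiplicity_mul (mul_ne_zero (hm ha) (hm ha)),
    rootMultiplicity_mul (mul_ne_zero (by simpa using hc') (mul_ne_zero (hm hb) (hm hb))),
    rootMultiplicity_mul (mul_ne_zero (hm hb) (hm hb)), rootMultiplicity_C] at h3
  have h1 : rootMultiplicity z (f.map (algebraMap F K)) = 1 := by
    have hpos : 0 < rootMultiplicity z (f.map (algebraMap F K)) := by
      rw [rootMultiplicity_pos (hm hf), IsRoot.def, eval_map_algebraMap, hz]
    have hle : ¬ 1 < rootMultiplicity z (f.map (algebraMap F K)) := by
      rw [one_lt_rootMultiplicity_iff_isRoot (hm hf), IsRoot.def, IsRoot.def, derivative_map,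
        eval_map_algebraMap, eval_map_algebraMap]
      exact fun h => hz' h.2
    omega
  omega

lemma pow_sub_dvd_hasseDeriv_pow (f : F[X]) (N k : ℕ) :
    f ^ (N - k) ∣ hasseDeriv k (f ^ N) := by
  induction N generalizing k with
  | zero => simp
  | succ N ih =>
    rw [pow_succ', hasseDeriv_mul]
    refine Finset.dvd_sum fun ij hij => ?_
    rw [Finset.HasAntidiagonal.mem_antidiagonal] at hij
    rcases Nat.eq_zero_or_pos ij.1 with h0 | h0
    · have hk : ij.2 = k := by omega
      rw [h0, hasseDeriv_zero', hk]
      refine (pow_dvd_pow f (show N + 1 - k ≤ (N - k) + 1 by omega)).trans ?_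
      rw [pow_succ']
      exact mul_dvd_mul_left f (ih k)
    · exact ((pow_dvd_pow f (by omega)).trans (ih ij.2)).mul_left _

lemma exists_hasseDeriv_pow_eq (f : F[X]) (N k : ℕ) (hk : k ≤ N) :
    ∃ H : F[X], hasseDeriv k (f ^ N) = f ^ (N - k) * H ∧ H.natDegree ≤ k * f.natDegree := by
  obtain ⟨H, hH⟩ := pow_sub_dvd_hasseDeriv_pow f N k
  by_cases h0 : f ^ (N - k) * H = 0
  · exact ⟨0, by rw [hH, h0, mul_zero], by simp⟩
  refine ⟨H, hH, ?_⟩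
  have h1 := natDegree_hasseDeriv_le (f ^ N) k
  rw [hH, natDegree_mul (left_ne_zero_of_mul h0) (right_ne_zero_of_mul h0), natDegree_pow,
    natDegree_pow] at h1
  obtain ⟨d, rfl⟩ := Nat.exists_eq_add_of_le hk
  rw [Nat.add_sub_cancel_left, add_mul] at h1
  omega

/-- The auxiliary polynomial of Stepanov's method. -/
noncomputable def stepanovPoly (f : F[X]) (N : ℕ) {J : ℕ} (a b : Fin J → F[X]) : F[X] :=
  ∑ j : Fin J, (a j + b j * f ^ N) * X ^ (Fintype.card F * (j : ℕ))

/-- The polynomial controlling the `k`-th Hasse derivative of `stepanovPoly` at the points where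
`f ^ N = -1`. -/
noncomputable def stepanovCond (f : F[X]) (H : ℕ → F[X]) {J : ℕ} (k : ℕ) :
    ((Fin J → F[X]) × (Fin J → F[X])) →ₗ[F] F[X] where
  toFun v := ∑ j : Fin J, X ^ (j : ℕ) * (f ^ k * hasseDeriv k (v.1 j) -
    ∑ i ∈ Finset.HasAntidiagonal.antidiagonal k, f ^ i.1 * hasseDeriv i.1 (v.2 j) * H i.2)
  map_add' v w := by
    simp only [Prod.fst_add, Prod.snd_add, Pi.add_apply, map_add, mul_add, add_mul,
      Finset.sum_add_distrib, mul_sub, Finset.mul_sum]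
    rw [← Finset.sum_add_distrib]
    refine Finset.sum_congr rfl fun j _ => ?_
    ring
  map_smul' c v := by
    simp only [Prod.smul_fst, Prod.smul_snd, Pi.smul_apply, map_smul, RingHom.id_apply,
      Finset.smul_sum, mul_smul_comm, smul_mul_assoc]
    simp only [← Finset.smul_sum, ← smul_sub, mul_smul_comm]

lemma natDegree_stepanovCond_lt {f : F[X]} {H : ℕ → F[X]} {J K k m : ℕ} (hJ : 0 < J)
    (hK : 0 < K) (hf : f.natDegree ≤ m) (hH : ∀ i ≤ k, (H i).natDegree ≤ i * f.natDegree)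
    (v : (Fin J → F[X]) × (Fin J → F[X])) (h1 : ∀ j, (v.1 j).natDegree < K)
    (h2 : ∀ j, (v.2 j).natDegree < K) :
    (stepanovCond f H k v).natDegree < K + J + m * k := by
  have hb : ∀ {i : ℕ} {g : F[X]}, g.natDegree < K →
      (f ^ i * hasseDeriv i g).natDegree ≤ m * i + (K - 1) := fun {i g} hg => by
    refine natDegree_mul_le.trans (add_le_add ?_ ?_)
    · exact natDegree_pow_le.trans (by rw [mul_comm]; gcongr)
    · have := natDegree_hasseDeriv_le g i
      omega
  refine lt_of_le_of_lt (b := J - 1 + (m * k + (K - 1))) ?_ (by omega)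
  simp only [stepanovCond, LinearMap.coe_mk, AddHom.coe_mk]
  refine natDegree_sum_le_of_forall_le _ _ fun j _ => ?_
  refine natDegree_mul_le.trans (add_le_add ?_ ?_)
  · rw [natDegree_X_pow]; omega
  refine (natDegree_sub_le _ _).trans (max_le (hb (h1 j)) ?_)
  refine natDegree_sum_le_of_forall_le _ _ fun i hi => ?_
  rw [Finset.HasAntidiagonal.mem_antidiagonal] at hi
  refine natDegree_mul_le.trans ?_
  have e1 := hb (i := i.1) (h2 j)
  have e2 : (H i.2).natDegree ≤ m * i.2 :=
    (hH i.2 (by omega)).trans (by rw [mul_comm]; gcongr)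
  have e3 : m * k = m * i.1 + m * i.2 := by rw [← mul_add, hi]
  omega

lemma pow_dvd_stepanovPoly {f : F[X]} {H : ℕ → F[X]} {J ℓ N : ℕ} (hℓN : ℓ ≤ N)
    (hℓ : ℓ ≤ Fintype.card F)
    (hH : ∀ i < ℓ, hasseDeriv i (f ^ N) = f ^ (N - i) * H i)
    (a b : Fin J → F[X]) (hcond : ∀ k < ℓ, stepanovCond f H k (a, b) = 0)
    {t : F} (ht : f.eval t ^ N = -1) (ht0 : f.eval t ≠ 0) :
    (X - C t) ^ ℓ ∣ stepanovPoly f N a b := by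
  have key : X ^ ℓ ∣ taylor t (stepanovPoly f N a b) := by
    have hX : X ^ ℓ ∣ taylor t (stepanovPoly f N a b) -
        ∑ j : Fin J, taylor t (a j + b j * f ^ N) * C (t ^ (j : ℕ)) := by
      have e : taylor t (stepanovPoly f N a b) = ∑ j : Fin J, taylor t (a j + b j * f ^ N) *
          (X ^ Fintype.card F + C t) ^ (j : ℕ) := by
        rw [stepanovPoly, map_sum]
        refine Finset.sum_congr rfl fun j _ => ?_
        rw [taylor_mul, pow_mul, taylor_pow, taylor_pow, taylor_X]
        congr 2
        rw [← FiniteField.expand_card]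
        simp
      rw [e, ← Finset.sum_sub_distrib]
      refine Finset.dvd_sum fun j _ => ?_
      rw [← mul_sub]
      refine Dvd.dvd.mul_left ?_ _
      rw [C_pow]
      refine dvd_trans ?_ (sub_dvd_pow_sub_pow _ _ _)
      simpa using pow_dvd_pow (X : F[X]) hℓ
    have hY : X ^ ℓ ∣ ∑ j : Fin J, taylor t (a j + b j * f ^ N) * C (t ^ (j : ℕ)) := by
      rw [X_pow_dvd_iff]
      intro k hk
      have hc := congrArg (eval t) (hcond k hk)
      rw [finsetSum_coeff]
      simp only [coeff_mul_C, taylor_coeff]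
      refine (mul_eq_zero.1 (?_ : f.eval t ^ k * _ = 0)).resolve_left (pow_ne_zero _ ht0)
      rw [← eval_zero (x := t), ← hc]
      simp only [stepanovCond, LinearMap.coe_mk, AddHom.coe_mk, eval_finsetSum, eval_mul,
        eval_pow, eval_X, eval_sub, map_add, hasseDeriv_mul, eval_add, Finset.mul_sum]
      refine Finset.sum_congr rfl fun j _ => ?_
      rw [mul_comm (t ^ (j : ℕ)), ← mul_assoc]
      congr 1
      rw [mul_add, sub_eq_add_neg, ← Finset.sum_neg_distrib, Finset.mul_sum]
      congr 1
      refine Finset.sum_congr rfl fun i hi => ?_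
      rw [Finset.HasAntidiagonal.mem_antidiagonal] at hi
      rw [hH i.2 (by omega), eval_mul, eval_pow]
      have e1 : f.eval t ^ k * f.eval t ^ (N - i.2) = - f.eval t ^ i.1 := by
        rw [← pow_add, show k + (N - i.2) = i.1 + N by omega, pow_add, ht]; ring
      linear_combination (eval t (hasseDeriv i.1 (b j)) * eval t (H i.2)) * e1
    simpa using dvd_add hX hY
  have := map_dvd (taylorAlgHom (-t)) key
  simpa [taylorAlgHom_apply, taylor_taylor, sub_eq_add_neg, taylor_zero] using this

lemma eq_zero_of_stepanovPoly_eq_zero {f : F[X]} (hf : NonSq f) (h0 : f.eval 0 ≠ 0) {N J K m : ℕ}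
    (hq : Fintype.card F = 2 * N + 1) (hm : f.natDegree ≤ m) (hKm : 2 * (K - 1) + m ≤ 2 * N)
    (a b : Fin J → F[X]) (ha : ∀ j, (a j).natDegree < K) (hb : ∀ j, (b j).natDegree < K)
    (hR : stepanovPoly f N a b = 0) : a = 0 ∧ b = 0 := by
  have hall : ∀ i : ℕ, ∀ hi : i < J, a ⟨i, hi⟩ = 0 ∧ b ⟨i, hi⟩ = 0 := by
    intro i
    induction i using Nat.strong_induction_on with
    | _ i ih =>
    intro hi
    set q := Fintype.card F with hqdef
    have hqpos : 0 < q := by omega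
    have hd : X ^ q ∣ a ⟨i, hi⟩ + b ⟨i, hi⟩ * f ^ N := by
      have hd2 : X ^ (q * i + q) ∣ (a ⟨i, hi⟩ + b ⟨i, hi⟩ * f ^ N) * X ^ (q * i) := by
        rw [stepanovPoly, ← Finset.add_sum_erase _ _ (Finset.mem_univ ⟨i, hi⟩)] at hR
        rw [eq_neg_of_add_eq_zero_left hR, dvd_neg]
        refine Finset.dvd_sum fun j hj => ?_
        rcases lt_or_ge (j : ℕ) i with hlt | hge
        · have := ih j hlt j.2
          simp only [Fin.eta] at this
          simp [this.1, this.2]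
        · have hne : (j : ℕ) ≠ i := fun h => Finset.ne_of_mem_erase hj (Fin.ext h)
          refine Dvd.dvd.mul_left (pow_dvd_pow _ ?_) _
          calc q * i + q = q * (i + 1) := by ring
            _ ≤ q * j := by gcongr; omega
      rw [pow_add, mul_comm _ (X ^ (q * i))] at hd2
      exact (mul_dvd_mul_iff_left (pow_ne_zero _ X_ne_zero)).1 hd2
    have hfq : X ^ q ∣ f ^ q - C (f.eval 0) := by
      rw [hqdef, ← FiniteField.expand_card f, X_pow_dvd_iff]
      intro d hd
      rw [coeff_sub, coeff_expand hqpos, coeff_C]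
      rcases Nat.eq_zero_or_pos d with rfl | hd0
      · simp [coeff_zero_eq_eval_zero]
      · rw [if_neg fun h => absurd (Nat.le_of_dvd hd0 h) (by omega), if_neg (by omega), sub_zero]
    have hd3 : X ^ q ∣ a ⟨i, hi⟩ ^ 2 * f - C (f.eval 0) * b ⟨i, hi⟩ ^ 2 := by
      have e : a ⟨i, hi⟩ ^ 2 * f - C (f.eval 0) * b ⟨i, hi⟩ ^ 2 =
          (a ⟨i, hi⟩ + b ⟨i, hi⟩ * f ^ N) * ((a ⟨i, hi⟩ - b ⟨i, hi⟩ * f ^ N) * f) +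
          b ⟨i, hi⟩ ^ 2 * (f ^ q - C (f.eval 0)) := by
        rw [hq]; ring
      rw [e]
      exact dvd_add (hd.mul_right _) (hfq.mul_left _)
    have hz : a ⟨i, hi⟩ ^ 2 * f - C (f.eval 0) * b ⟨i, hi⟩ ^ 2 = 0 := by
      refine eq_zero_of_dvd_of_natDegree_lt hd3 ?_
      rw [natDegree_X_pow]
      refine lt_of_le_of_lt (natDegree_sub_le _ _) (max_lt ?_ ?_)
      · refine lt_of_le_of_lt natDegree_mul_le ?_
        rw [natDegree_pow]
        have := ha ⟨i, hi⟩
        omega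
      · refine lt_of_le_of_lt (natDegree_C_mul_le _ _) ?_
        rw [natDegree_pow]
        have := hb ⟨i, hi⟩
        omega
    have ha0 : a ⟨i, hi⟩ = 0 := hf _ _ _ (sub_eq_zero.1 hz)
    refine ⟨ha0, ?_⟩
    rw [ha0] at hz
    simpa [h0] using hz
  exact ⟨funext fun j => (hall j j.2).1, funext fun j => (hall j j.2).2⟩

lemma finrank_degreeLT (n : ℕ) : Module.finrank F (degreeLT F n) = n := by
  rw [(degreeLTEquiv F n).finrank_eq, Module.finrank_fin_fun]

lemma natDegree_lt_of_mem_degreeLT {n : ℕ} (hn : 0 < n) {g : F[X]} (hg : g ∈ degreeLT F n) :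
    g.natDegree < n := by
  by_cases h : g = 0
  · simpa [h] using hn
  · exact (natDegree_lt_iff_degree_lt h).2 (mem_degreeLT.1 hg)

/-- Existence of the auxiliary polynomial of Stepanov's method, by counting dimensions. -/
lemma exists_stepanov_coeffs (f : F[X]) (H : ℕ → F[X]) {J K ℓ m : ℕ} (hJ : 0 < J) (hK : 0 < K)
    (hf : f.natDegree ≤ m) (hH : ∀ i < ℓ, (H i).natDegree ≤ i * f.natDegree)
    (hdim : ℓ * (K + J + m * ℓ) < 2 * J * K) :
    ∃ a b : Fin J → F[X], ¬ (a = 0 ∧ b = 0) ∧ (∀ j, (a j).natDegree < K) ∧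
      (∀ j, (b j).natDegree < K) ∧ ∀ k < ℓ, stepanovCond f H k (a, b) = 0 := by
  let V := (Fin J → degreeLT F K) × (Fin J → degreeLT F K)
  let ι : V →ₗ[F] (Fin J → F[X]) × (Fin J → F[X]) :=
    LinearMap.prodMap ((degreeLT F K).subtype.compLeft (Fin J))
      ((degreeLT F K).subtype.compLeft (Fin J))
  let Λ : V →ₗ[F] (Fin ℓ → Fin (K + J + m * ℓ) → F) :=
    LinearMap.pi fun k => LinearMap.pi fun d => lcoeff F d ∘ₗ stepanovCond f H (k : ℕ) ∘ₗ ι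
  have : FiniteDimensional F (degreeLT F K) := (degreeLTEquiv F K).symm.finiteDimensional
  have hker : LinearMap.ker Λ ≠ ⊥ := by
    apply LinearMap.ker_ne_bot_of_finrank_lt
    simp only [V, Module.finrank_prod, Module.finrank_pi_fintype, finrank_degreeLT,
      Finset.sum_const, Finset.card_univ, Fintype.card_fin, smul_eq_mul,
      Module.finrank_self]
    nlinarith
  obtain ⟨v, hv, hv0⟩ := (Submodule.ne_bot_iff _).1 hker
  have h1 : ∀ j, ((ι v).1 j).natDegree < K := fun j => natDegree_lt_of_mem_degreeLT hK (v.1 j).2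
  have h2 : ∀ j, ((ι v).2 j).natDegree < K := fun j => natDegree_lt_of_mem_degreeLT hK (v.2 j).2
  refine ⟨(ι v).1, (ι v).2, ?_, h1, h2, ?_⟩
  · rintro ⟨e1, e2⟩
    refine hv0 (Prod.ext (funext fun j => ?_) (funext fun j => ?_))
    · exact Subtype.ext (congrFun e1 j)
    · exact Subtype.ext (congrFun e2 j)
  · intro k hk
    have hdeg := natDegree_stepanovCond_lt (k := k) hJ hK hf (fun i hi => hH i (by omega)) _ h1 h2
    ext d
    rw [coeff_zero]
    by_cases hd : d < K + J + m * ℓ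
    · exact congrFun (congrFun (LinearMap.mem_ker.1 hv) ⟨k, hk⟩) ⟨d, hd⟩
    · refine coeff_eq_zero_of_natDegree_lt (hdeg.trans_le ?_)
      have : m * k ≤ m * ℓ := by gcongr
      omega

lemma natDegree_stepanovPoly_le {f : F[X]} {N J K m : ℕ} (hm : f.natDegree ≤ m)
    (a b : Fin J → F[X]) (ha : ∀ j, (a j).natDegree < K) (hb : ∀ j, (b j).natDegree < K) :
    (stepanovPoly f N a b).natDegree ≤ K + m * N + Fintype.card F * (J - 1) := by
  refine natDegree_sum_le_of_forall_le _ _ fun j _ => ?_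
  refine natDegree_mul_le.trans (add_le_add ?_ ?_)
  · refine (natDegree_add_le _ _).trans (max_le ?_ ?_)
    · have := ha j
      omega
    · refine natDegree_mul_le.trans (add_le_add (hb j).le ?_)
      exact natDegree_pow_le.trans (by rw [mul_comm]; gcongr)
  · rw [natDegree_X_pow]
    gcongr
    omega

open Classical in
/-- The elements at which `f` takes a nonzero nonsquare value. -/
noncomputable def nonsquareSet (f : F[X]) : Finset F :=
  Finset.univ.filter fun t => f.eval t ≠ 0 ∧ ¬ IsSquare (f.eval t)

lemma card_nonsquareSet_le_of_eval_zero_ne {f : F[X]} (h2 : ringChar F ≠ 2)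
    (hq : 9887 < Fintype.card F) (hf : NonSq f) (hm : f.natDegree ≤ 8) (h0 : f.eval 0 ≠ 0) :
    8 * (nonsquareSet f).card ≤ 5 * Fintype.card F := by
  obtain ⟨N, hN⟩ : ∃ N, Fintype.card F = 2 * N + 1 := by
    have := FiniteField.odd_card_of_char_ne_two h2
    exact ⟨Fintype.card F / 2, by omega⟩
  have hN2 : Fintype.card F / 2 = N := by omega
  have hex : ∀ i, ∃ H : F[X], i < 60 →
      (hasseDeriv i (f ^ N) = f ^ (N - i) * H ∧ H.natDegree ≤ i * f.natDegree) := by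
    intro i
    by_cases hi : i < 60
    · obtain ⟨H, h⟩ := exists_hasseDeriv_pow_eq f N i (by omega)
      exact ⟨H, fun _ => h⟩
    · exact ⟨0, fun h => absurd h hi⟩
  choose H hH using hex
  obtain ⟨a, b, hab, ha, hb, hcond⟩ := exists_stepanov_coeffs f H (J := 34) (K := N - 3) (ℓ := 60)
    (m := 8) (by norm_num) (by omega) hm (fun i hi => (hH i hi).2) (by omega)
  have hR : stepanovPoly f N a b ≠ 0 := fun h =>
    hab (eq_zero_of_stepanovPoly_eq_zero hf h0 hN hm (by omega) a b ha hb h)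
  have hdvd : ∏ t ∈ nonsquareSet f, (X - C t) ^ 60 ∣ stepanovPoly f N a b := by
    refine Finset.prod_dvd_of_coprime ?_ ?_
    · intro s _ t _ hst
      exact (pairwise_coprime_X_sub_C Function.injective_id hst).pow
    · intro t ht
      simp only [nonsquareSet, Finset.mem_filter, Finset.mem_univ, true_and] at ht
      refine pow_dvd_stepanovPoly (by omega) (by omega) (fun i hi => (hH i hi).1) a b hcond ?_ ht.1
      rw [FiniteField.isSquare_iff h2 ht.1] at ht
      have := FiniteField.pow_dichotomy h2 ht.1
      rw [hN2] at *
      exact this.resolve_left ht.2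
  have hdeg := natDegree_le_of_dvd hdvd hR
  rw [natDegree_prod _ _ fun t _ => pow_ne_zero _ (X_sub_C_ne_zero t)] at hdeg
  simp only [natDegree_pow, natDegree_X_sub_C, Finset.sum_const, smul_eq_mul] at hdeg
  have := natDegree_stepanovPoly_le (N := N) hm a b ha hb
  omega

/-- Stepanov's bound: a polynomial of degree at most eight which is not a constant times a square
has a positive proportion of values which are not nonzero nonsquares. -/
lemma card_nonsquareSet_le {f : F[X]} (h2 : ringChar F ≠ 2)
    (hq : 9887 < Fintype.card F) (hf : NonSq f) (hm : f.natDegree ≤ 8) :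
    8 * (nonsquareSet f).card ≤ 5 * Fintype.card F := by
  obtain ⟨c, hc⟩ : ∃ c, f.eval c ≠ 0 := by
    by_contra! h
    refine hf.ne_zero (eq_zero_of_natDegree_lt_card_of_eval_eq_zero' f Finset.univ
      (fun c _ => h c) ?_)
    rw [Finset.card_univ]
    omega
  have h := card_nonsquareSet_le_of_eval_zero_ne h2 hq (hf.taylor c)
    (by rwa [natDegree_taylor]) (by simpa [taylor_eval] using hc)
  refine le_trans (Nat.mul_le_mul_left 8 ?_) h
  refine Finset.card_le_card_of_injOn (· - c) ?_ (fun x _ y _ h => sub_left_injective h)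
  intro t ht
  simpa [nonsquareSet, taylor_eval] using ht

open Classical in
/-- The elements at which `f` takes a nonzero square value. -/
noncomputable def squareSet (f : F[X]) : Finset F :=
  Finset.univ.filter fun t => f.eval t ≠ 0 ∧ IsSquare (f.eval t)

lemma mem_squareSet {f : F[X]} {t : F} :
    t ∈ squareSet f ↔ f.eval t ≠ 0 ∧ IsSquare (f.eval t) := by
  simp [squareSet]

lemma mem_nonsquareSet {f : F[X]} {t : F} :
    t ∈ nonsquareSet f ↔ f.eval t ≠ 0 ∧ ¬ IsSquare (f.eval t) := by
  simp [nonsquareSet]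

lemma le_card_squareSet {f : F[X]} (h2 : ringChar F ≠ 2)
    (hq : 9887 < Fintype.card F) (hf : NonSq f) (hm : f.natDegree ≤ 4) :
    3 * Fintype.card F ≤ 8 * (squareSet f).card + 32 := by
  have h1 := card_nonsquareSet_le h2 hq hf (hm.trans (by norm_num))
  have h3 : (Finset.univ : Finset F) ⊆ squareSet f ∪ (nonsquareSet f ∪ f.roots.toFinset) := by
    intro t _
    simp only [Finset.mem_union, mem_squareSet, mem_nonsquareSet, Multiset.mem_toFinset,
      mem_roots hf.ne_zero, IsRoot.def]
    tauto
  have h4 := Finset.card_le_card h3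
  have h5 := Finset.card_union_le (squareSet f) (nonsquareSet f ∪ f.roots.toFinset)
  have h6 := Finset.card_union_le (nonsquareSet f) f.roots.toFinset
  have h7 := (Multiset.toFinset_card_le f.roots).trans (card_roots' f)
  rw [Finset.card_univ] at h4
  omega

/-- There is an element with nonzero square value outside any set of at most three elements. -/
lemma exists_mem_squareSet_notMem {f : F[X]} (h2 : ringChar F ≠ 2)
    (hq : 9887 < Fintype.card F) (hf : NonSq f) (hm : f.natDegree ≤ 4)
    (S : Finset F) (hS : S.card ≤ 3) : ∃ t ∈ squareSet f, t ∉ S := by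
  apply Finset.exists_mem_notMem_of_card_lt_card
  have := le_card_squareSet h2 hq hf hm
  omega

/-- If `B` and its transform `B₂` under the involution `u ↦ (βu - α) / (γu - β)` have a product
which is not a constant times a square, then the involution matches two distinct elements at which
`B` takes nonzero square values. -/
lemma exists_matched_squares {B B₂ : F[X]} (h2 : ringChar F ≠ 2) (hq : 9887 < Fintype.card F)
    (hB : NonSq B) (hm : B.natDegree ≤ 4) (hm₂ : B₂.natDegree ≤ 4) {α β γ : F}
    (hdet : β ^ 2 ≠ α * γ)
    (hB₂ : ∀ u, γ * u - β ≠ 0 →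
      B₂.eval u = (γ * u - β) ^ 4 * B.eval ((β * u - α) / (γ * u - β)))
    (hF : NonSq (B * B₂)) :
    ∃ s ∈ squareSet B, ∃ t ∈ squareSet B, s ≠ t ∧ α - β * (s + t) + γ * s * t = 0 := by
  by_contra! hno
  have two_ne : (2 : F) ≠ 0 := Ring.two_ne_zero h2
  set m : F → F := fun u => (β * u - α) / (γ * u - β) with hmdef
  set P : F[X] := (C γ * X - C β) * (C γ * X ^ 2 - C (2 * β) * X + C α) with hP
  have hP0 : P ≠ 0 := by
    refine mul_ne_zero (fun h => hdet ?_) (fun h => hdet ?_)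
    · have e0 := congrArg (coeff · 0) h
      have e1 := congrArg (coeff · 1) h
      simp [coeff_X, coeff_C] at e0 e1
      simp [e0, e1]
    · have e0 := congrArg (coeff · 1) h
      have e1 := congrArg (coeff · 2) h
      simp [coeff_C, two_ne] at e0 e1
      simp [e0, e1]
  have hPdeg : P.natDegree ≤ 3 := by rw [hP]; compute_degree
  set A := squareSet B \ P.roots.toFinset with hA
  have hAcard : (squareSet B).card ≤ A.card + 3 := by
    have h1 := (Multiset.toFinset_card_le P.roots).trans (card_roots' P)
    have h3 := Finset.le_card_sdiff P.roots.toFinset (squareSet B)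
    rw [← hA] at h3
    omega
  have hmem : ∀ u ∈ A, u ∈ squareSet B ∧ γ * u - β ≠ 0 ∧ γ * u ^ 2 - 2 * β * u + α ≠ 0 := by
    intro u hu
    rw [hA, Finset.mem_sdiff, Multiset.mem_toFinset, mem_roots hP0, IsRoot.def, hP] at hu
    simp only [eval_mul, eval_sub, eval_add, eval_C, eval_X, eval_pow, mul_eq_zero, not_or] at hu
    exact ⟨hu.1, hu.2.1, hu.2.2⟩
  have hD : ∀ u ∈ A, γ * m u - β ≠ 0 := by
    intro u hu
    obtain ⟨-, h1, -⟩ := hmem u hu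
    have : γ * m u - β = (β ^ 2 - α * γ) / (γ * u - β) := by
      simp only [hmdef]; field_simp; ring
    rw [this]
    exact div_ne_zero (sub_ne_zero.2 hdet) h1
  have hmm : ∀ u ∈ A, m (m u) = u := by
    intro u hu
    have h3 := hD u hu
    obtain ⟨-, h1, -⟩ := hmem u hu
    have e : m u * (γ * u - β) = β * u - α := div_mul_cancel₀ _ h1
    change (β * m u - α) / (γ * m u - β) = u
    rw [div_eq_iff h3]
    linear_combination -e
  have hnot : ∀ u ∈ A, m u ∉ squareSet B := by
    intro u hu hmu
    obtain ⟨h0, h1, h3⟩ := hmem u hu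
    have e : m u * (γ * u - β) = β * u - α := div_mul_cancel₀ _ h1
    refine hno u h0 (m u) hmu ?_ (by linear_combination e)
    intro h
    rw [← h] at e
    exact h3 (by linear_combination e)
  have hsq : ∀ {x y d : F}, x ≠ 0 → IsSquare x → d ≠ 0 → ¬ (y ≠ 0 ∧ IsSquare y) →
      x * (d ^ 4 * y) = 0 ∨ (x * (d ^ 4 * y) ≠ 0 ∧ ¬ IsSquare (x * (d ^ 4 * y))) := by
    intro x y d hx hxs hd hy
    by_cases hy0 : y = 0
    · left; simp [hy0]
    · refine Or.inr ⟨by positivity, fun hs => hy ⟨hy0, ?_⟩⟩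
      obtain ⟨r, rfl⟩ := hxs
      obtain ⟨w, hw⟩ := hs
      have hr : r ≠ 0 := by rintro rfl; simp at hx
      refine ⟨w / (r * d ^ 2), ?_⟩
      field_simp
      linear_combination hw
  have hsub : A ∪ A.image m ⊆ nonsquareSet (B * B₂) ∪ (B * B₂).roots.toFinset := by
    have hF' : ∀ v, (B * B₂).eval v = 0 ∨ ((B * B₂).eval v ≠ 0 ∧ ¬ IsSquare ((B * B₂).eval v)) →
        v ∈ nonsquareSet (B * B₂) ∪ (B * B₂).roots.toFinset := by
      intro v hv
      rw [Finset.mem_union, mem_nonsquareSet, Multiset.mem_toFinset, mem_roots hF.ne_zero]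
      exact hv.symm
    intro v hv
    apply hF'
    rw [eval_mul]
    rcases Finset.mem_union.1 hv with hv | hv
    · obtain ⟨h0, h1, -⟩ := hmem v hv
      rw [mem_squareSet] at h0
      rw [hB₂ v h1]
      exact hsq h0.1 h0.2 h1 (by simpa only [mem_squareSet] using hnot v hv)
    · obtain ⟨u, hu, rfl⟩ := Finset.mem_image.1 hv
      obtain ⟨h0, h1, -⟩ := hmem u hu
      rw [mem_squareSet] at h0
      have h3 := hmm u hu
      rw [hB₂ _ (hD u hu)]
      change B.eval (m u) * (_ * B.eval (m (m u))) = 0 ∨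
        (B.eval (m u) * (_ * B.eval (m (m u))) ≠ 0 ∧ ¬ IsSquare (B.eval (m u) * (_ * B.eval (m (m u)))))
      rw [h3]
      have := hsq h0.1 h0.2 (hD u hu) (by simpa only [mem_squareSet] using hnot u hu)
      rwa [mul_left_comm, mul_comm (B.eval u), ← mul_assoc, mul_comm _ (B.eval (m u)), mul_assoc]
        at this
  have hdisj : Disjoint A (A.image m) := by
    rw [Finset.disjoint_left]
    intro v hv hv'
    obtain ⟨u, hu, rfl⟩ := Finset.mem_image.1 hv'
    exact hnot u hu (hmem _ hv).1
  have hinj : (A.image m).card = A.card := by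
    refine Finset.card_image_of_injOn fun u hu v hv h => ?_
    rw [← hmm u hu, ← hmm v hv]
    exact congrArg m h
  have c1 := Finset.card_le_card hsub
  rw [Finset.card_union_of_disjoint hdisj, hinj] at c1
  have c2 := Finset.card_union_le (nonsquareSet (B * B₂)) (B * B₂).roots.toFinset
  have c3 := (Multiset.toFinset_card_le (B * B₂).roots).trans (card_roots' _)
  have c4 : (B * B₂).natDegree ≤ 8 := natDegree_mul_le.trans (by omega)
  have c5 := card_nonsquareSet_le h2 hq hF c4
  have c6 := le_card_squareSet h2 hq hB hm
  omega

lemma nonSq_mul_of_simple_root {K : Type*} [Field K] [Algebra F K] {f g : F[X]} (z : K)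
    (hz : aeval z f = 0) (hz' : aeval z (derivative f) ≠ 0) (hg : aeval z g ≠ 0) :
    NonSq (f * g) := by
  refine nonSq_of_simple_root z (by simp [hz]) ?_
  simp only [derivative_mul, map_add, map_mul, hz, zero_mul, add_zero]
  exact mul_ne_zero hz' hg

/-- The branch quartic of the degree two map `y / (x - e)` on the curve `y² = x³ - e³`. -/
noncomputable def branchQuartic (e : F) : F[X] := X ^ 4 - C (6 * e) * X ^ 2 - C (3 * e ^ 2)

lemma natDegree_branchQuartic_le (e : F) : (branchQuartic e).natDegree ≤ 4 := by
  rw [branchQuartic]; compute_degree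

lemma exists_roots_branchQuartic (h2 : (2 : F) ≠ 0) (h3 : (3 : F) ≠ 0) {e : F} (he : e ≠ 0) :
    ∃ ε z₁ z₂ : AlgebraicClosure F, ε = algebraMap F _ e ∧ z₁ ^ 2 ≠ z₂ ^ 2 ∧ z₁ ≠ 0 ∧ z₂ ≠ 0 ∧
      z₁ ^ 4 = 6 * ε * z₁ ^ 2 + 3 * ε ^ 2 ∧ z₂ ^ 4 = 6 * ε * z₂ ^ 2 + 3 * ε ^ 2 ∧
      z₁ ^ 2 ≠ 3 * ε ∧ z₂ ^ 2 ≠ 3 * ε := by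
  have inj := FaithfulSMul.algebraMap_injective F (AlgebraicClosure F)
  have h2' : (2 : AlgebraicClosure F) ≠ 0 := by
    intro h; apply h2; apply inj; simpa only [map_ofNat, map_zero] using h
  have h3' : (3 : AlgebraicClosure F) ≠ 0 := by
    intro h; apply h3; apply inj; simpa only [map_ofNat, map_zero] using h
  set ε := algebraMap F (AlgebraicClosure F) e with hε
  have hε0 : ε ≠ 0 := by simpa [hε] using he
  obtain ⟨s, hs⟩ := IsAlgClosed.exists_pow_nat_eq (3 : AlgebraicClosure F) (n := 2) (by norm_num)
  obtain ⟨z₁, hz₁⟩ := IsAlgClosed.exists_pow_nat_eq (3 * ε + 2 * s * ε) (n := 2) (by norm_num)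
  obtain ⟨z₂, hz₂⟩ := IsAlgClosed.exists_pow_nat_eq (3 * ε - 2 * s * ε) (n := 2) (by norm_num)
  have hs0 : s ≠ 0 := by rintro rfl; apply h3'; rw [← hs]; simp
  have hsε : 2 * s * ε ≠ 0 := mul_ne_zero (mul_ne_zero h2' hs0) hε0
  have q₁ : z₁ ^ 4 = 6 * ε * z₁ ^ 2 + 3 * ε ^ 2 := by
    linear_combination (z₁ ^ 2 - 3 * ε + 2 * s * ε) * hz₁ + 4 * ε ^ 2 * hs
  have q₂ : z₂ ^ 4 = 6 * ε * z₂ ^ 2 + 3 * ε ^ 2 := by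
    linear_combination (z₂ ^ 2 - 3 * ε - 2 * s * ε) * hz₂ + 4 * ε ^ 2 * hs
  have hne : 3 * ε ^ 2 ≠ 0 := mul_ne_zero h3' (pow_ne_zero _ hε0)
  refine ⟨ε, z₁, z₂, rfl, ?_, ?_, ?_, q₁, q₂, ?_, ?_⟩
  · intro h
    refine mul_ne_zero h2' hsε ?_
    linear_combination h - hz₁ + hz₂
  · rintro rfl; exact hne (by linear_combination -q₁)
  · rintro rfl; exact hne (by linear_combination -q₂)
  · intro h; exact hsε (by linear_combination h - hz₁)
  · intro h; exact hsε (by linear_combination hz₂ - h)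

lemma aeval_branchQuartic {e : F} {ε z : AlgebraicClosure F} (hε : ε = algebraMap F _ e) :
    aeval z (branchQuartic e) = z ^ 4 - 6 * ε * z ^ 2 - 3 * ε ^ 2 := by
  simp only [branchQuartic, hε, map_sub, map_mul, map_pow, aeval_X, aeval_C, map_ofNat]

lemma aeval_derivative_branchQuartic {e : F} {ε z : AlgebraicClosure F}
    (hε : ε = algebraMap F _ e) :
    aeval z (derivative (branchQuartic e)) = 4 * z * (z ^ 2 - 3 * ε) := by
  have h : derivative (branchQuartic e) = C 4 * X ^ 3 - C (6 * e) * (C 2 * X) := by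
    simp only [branchQuartic, derivative_sub, derivative_C_mul, derivative_X_pow, derivative_C]
    norm_num
  simp only [h, hε, map_sub, map_mul, map_pow, aeval_X, aeval_C, map_ofNat]
  ring

lemma nonSq_branchQuartic (h2 : (2 : F) ≠ 0) (h3 : (3 : F) ≠ 0) {e : F} (he : e ≠ 0) :
    NonSq (branchQuartic e) := by
  obtain ⟨ε, z, -, hε, -, hz0, -, hz, -, hz3, -⟩ := exists_roots_branchQuartic h2 h3 he
  have h4 : (4 : AlgebraicClosure F) ≠ 0 := by
    intro h
    apply mul_ne_zero h2 h2
    apply FaithfulSMul.algebraMap_injective F (AlgebraicClosure F)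
    simp only [map_mul, map_zero, map_ofNat]
    linear_combination h
  refine nonSq_of_simple_root z ?_ ?_
  · rw [aeval_branchQuartic hε, hz]; ring
  · rw [aeval_derivative_branchQuartic hε]
    exact mul_ne_zero (mul_ne_zero h4 hz0) (sub_ne_zero.2 hz3)

/-- A quartic whose product with `branchQuartic e` is a constant times a square is proportional
to `branchQuartic e`. -/
lemma coeffs_of_not_nonSq (h2 : (2 : F) ≠ 0) (h3 : (3 : F) ≠ 0) {e : F} (he : e ≠ 0)
    {c₀ c₁ c₂ c₃ c₄ : F} (h : ¬ NonSq (branchQuartic e *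
      (C c₄ * X ^ 4 + C c₃ * X ^ 3 + C c₂ * X ^ 2 + C c₁ * X + C c₀))) :
    c₃ = 0 ∧ c₁ = 0 ∧ 6 * e * c₄ + c₂ = 0 ∧ 3 * e ^ 2 * c₄ + c₀ = 0 := by
  obtain ⟨ε, z₁, z₂, hε, hne, hz₁, hz₂, q₁, q₂, d₁, d₂⟩ := exists_roots_branchQuartic h2 h3 he
  have inj := FaithfulSMul.algebraMap_injective F (AlgebraicClosure F)
  have h2' : (2 : AlgebraicClosure F) ≠ 0 := by
    intro h; apply h2; apply inj; simpa only [map_ofNat, map_zero] using h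
  have h4 : (4 : AlgebraicClosure F) ≠ 0 := by
    intro h; exact mul_ne_zero h2' h2' (by linear_combination h)
  set φ := algebraMap F (AlgebraicClosure F) with hφ
  have hroot : ∀ z : AlgebraicClosure F, z ≠ 0 → z ^ 2 ≠ 3 * ε →
      z ^ 4 = 6 * ε * z ^ 2 + 3 * ε ^ 2 →
      φ c₄ * z ^ 4 + φ c₃ * z ^ 3 + φ c₂ * z ^ 2 + φ c₁ * z + φ c₀ = 0 := by
    intro z hz0 hz3 hz
    by_contra hc
    refine h (nonSq_mul_of_simple_root z ?_ ?_ ?_)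
    · rw [aeval_branchQuartic hε, hz]; ring
    · rw [aeval_derivative_branchQuartic hε]
      exact mul_ne_zero (mul_ne_zero h4 hz0) (sub_ne_zero.2 hz3)
    · simpa using hc
  have hlin : ∀ z : AlgebraicClosure F, z ≠ 0 → z ^ 2 ≠ 3 * ε →
      z ^ 4 = 6 * ε * z ^ 2 + 3 * ε ^ 2 → φ c₃ * z ^ 2 + φ c₁ = 0 ∧
      (6 * ε * φ c₄ + φ c₂) * z ^ 2 + (3 * ε ^ 2 * φ c₄ + φ c₀) = 0 := by
    intro z hz0 hz3 hz
    have e1 := hroot z hz0 hz3 hz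
    have e2 := hroot (-z) (neg_ne_zero.2 hz0) (by simpa using hz3)
      (by linear_combination hz)
    constructor
    · refine mul_left_cancel₀ (mul_ne_zero h2' hz0) ?_
      linear_combination e1 - e2
    · refine mul_left_cancel₀ h2' ?_
      linear_combination e1 + e2 - 2 * φ c₄ * hz
  obtain ⟨a₁, b₁⟩ := hlin z₁ hz₁ d₁ q₁
  obtain ⟨a₂, b₂⟩ := hlin z₂ hz₂ d₂ q₂
  have g₃ : φ c₃ = 0 := by
    refine (mul_eq_zero.1 (?_ : φ c₃ * (z₁ ^ 2 - z₂ ^ 2) = 0)).resolve_right (sub_ne_zero.2 hne)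
    linear_combination a₁ - a₂
  have g₂ : 6 * ε * φ c₄ + φ c₂ = 0 := by
    refine (mul_eq_zero.1 (?_ : (6 * ε * φ c₄ + φ c₂) * (z₁ ^ 2 - z₂ ^ 2) = 0)).resolve_right
      (sub_ne_zero.2 hne)
    linear_combination b₁ - b₂
  have g₁ : φ c₁ = 0 := by linear_combination a₁ - z₁ ^ 2 * g₃
  have g₀ : 3 * ε ^ 2 * φ c₄ + φ c₀ = 0 := by linear_combination b₁ - z₁ ^ 2 * g₂
  refine ⟨inj (by simpa using g₃), inj (by simpa using g₁), inj ?_, inj ?_⟩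
  · rw [hε] at g₂; simpa only [map_add, map_mul, map_pow, map_zero, map_ofNat] using g₂
  · rw [hε] at g₀; simpa only [map_add, map_mul, map_pow, map_zero, map_ofNat] using g₀

/-- The involutions permuting the roots of `branchQuartic e`. -/
lemma involution_preserving_branchQuartic (h2 : (2 : F) ≠ 0) (h3 : (3 : F) ≠ 0) {e : F}
    (he : e ≠ 0) {α β γ : F} (hdet : β ^ 2 ≠ α * γ)
    (c₃ : -4 * β * (β ^ 2 * α - 3 * e * β ^ 2 * γ - 3 * e * α * γ ^ 2 - 3 * e ^ 2 * γ ^ 3) = 0)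
    (c₁ : -4 * β * (α ^ 3 - 3 * e * α * β ^ 2 - 3 * e * α ^ 2 * γ - 3 * e ^ 2 * γ * β ^ 2) = 0)
    (c₂ : 6 * e * (β ^ 4 - 6 * e * β ^ 2 * γ ^ 2 - 3 * e ^ 2 * γ ^ 4) +
      (6 * β ^ 2 * α ^ 2 - 6 * e * (β ^ 4 + 4 * α * β ^ 2 * γ + α ^ 2 * γ ^ 2) -
        18 * e ^ 2 * γ ^ 2 * β ^ 2) = 0)
    (c₀ : 3 * e ^ 2 * (β ^ 4 - 6 * e * β ^ 2 * γ ^ 2 - 3 * e ^ 2 * γ ^ 4) +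
      (α ^ 4 - 6 * e * α ^ 2 * β ^ 2 - 3 * e ^ 2 * β ^ 4) = 0) :
    (γ ≠ 0 ∧ β = 0 ∧ α ^ 2 = -3 * e ^ 2 * γ ^ 2) ∨ (γ = 0 ∧ α = 0 ∧ β ≠ 0) := by
  have h4 : (4 : F) ≠ 0 := by intro h; exact mul_ne_zero h2 h2 (by linear_combination h)
  by_cases hβ : β = 0
  · left
    subst hβ
    have hγ : γ ≠ 0 := by rintro rfl; simp at hdet
    refine ⟨hγ, rfl, ?_⟩
    refine mul_left_cancel₀ (mul_ne_zero (mul_ne_zero (mul_ne_zero h2 h3) he) (pow_ne_zero 2 hγ)) ?_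
    linear_combination -c₂
  right
  have hβ4 : -4 * β ≠ 0 := mul_ne_zero (neg_ne_zero.2 h4) hβ
  replace c₃ := (mul_eq_zero.1 c₃).resolve_left hβ4
  replace c₁ := (mul_eq_zero.1 c₁).resolve_left hβ4
  suffices hγ : γ = 0 by
    subst hγ
    refine ⟨rfl, ?_, hβ⟩
    refine (mul_eq_zero.1 (?_ : β ^ 2 * α = 0)).resolve_left (pow_ne_zero 2 hβ)
    linear_combination c₃
  by_contra hγ
  have hA : α - 3 * e * γ ≠ 0 := by
    intro h
    have : 12 * e ^ 2 * γ ^ 3 = 0 := by linear_combination (β ^ 2 - 3 * e * γ ^ 2) * h - c₃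
    refine mul_ne_zero (mul_ne_zero (mul_ne_zero h4 h3) (pow_ne_zero 2 he)) (pow_ne_zero 3 hγ) ?_
    linear_combination this
  have hB : α + e * γ ≠ 0 := by
    intro h
    have : 4 * (e * γ) * β ^ 2 = 0 := by linear_combination (β ^ 2 - 3 * e * γ ^ 2) * h - c₃
    exact mul_ne_zero (mul_ne_zero h4 (mul_ne_zero he hγ)) (pow_ne_zero 2 hβ) this
  have hβα : β ^ 2 = -(α * γ) := by
    have h5 : (β ^ 2 - α * γ) * (β ^ 2 + α * γ) = 0 := by
      refine mul_left_cancel₀ (mul_ne_zero (mul_ne_zero (mul_ne_zero h3 he) hA) hB) ?_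
      linear_combination (3 * e * β ^ 2 * (α + e * γ)) * c₃ - (3 * e * γ ^ 2 * (α + e * γ)) * c₁
    have := (mul_eq_zero.1 h5).resolve_left (sub_ne_zero.2 hdet)
    linear_combination this
  have hα : α ^ 2 = -3 * e ^ 2 * γ ^ 2 := by
    refine mul_left_cancel₀ hγ ?_
    linear_combination -c₃ + (α - 3 * e * γ) * hβα
  have h6 : α = e * γ := by
    have h6 : 72 * e ^ 2 * γ ^ 3 * (α - e * γ) = 0 := by
      linear_combination c₂ - (6 * α ^ 2 - 54 * e ^ 2 * γ ^ 2
        - 24 * e * α * γ) * hβα + (6 * α * γ - 18 * e * γ ^ 2) * hα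
    have h72 : 72 * e ^ 2 * γ ^ 3 ≠ 0 := by
      have : 72 * e ^ 2 * γ ^ 3 = 2 * 4 * (3 * 3) * e ^ 2 * γ ^ 3 := by ring
      rw [this]
      exact mul_ne_zero (mul_ne_zero (mul_ne_zero (mul_ne_zero h2 h4) (mul_ne_zero h3 h3))
        (pow_ne_zero 2 he)) (pow_ne_zero 3 hγ)
    exact sub_eq_zero.1 ((mul_eq_zero.1 h6).resolve_left h72)
  refine mul_ne_zero h4 (mul_ne_zero (pow_ne_zero 2 he) (pow_ne_zero 2 hγ)) ?_
  linear_combination hα - (α + e * γ) * h6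

/-- The values `q₀, q₁, q₂, q₃` of a functional on `1, x, y, x²` are such that no plane section
of the curve `y² = x³ - e³` in the kernel of the functional has four distinct rational points. -/
structure NoFourSecant (e q₀ q₁ q₂ q₃ : F) : Prop where
  affine : ∀ a₀ a₁ a₂ : F, a₀ * q₀ + a₁ * q₁ + a₂ * q₂ + q₃ = 0 → ∀ l : List (F × F), l.Nodup →
    (∀ P ∈ l, P.2 ^ 2 = P.1 ^ 3 - e ^ 3 ∧ a₀ + a₁ * P.1 + a₂ * P.2 + P.1 ^ 2 = 0) → l.length < 4
  line : ∀ a₀ a₁ : F, a₁ ≠ 0 → a₀ * q₀ + a₁ * q₁ + q₂ = 0 → ∀ l : List (F × F), l.Nodup →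
    (∀ P ∈ l, P.2 ^ 2 = P.1 ^ 3 - e ^ 3 ∧ a₀ + a₁ * P.1 + P.2 = 0) → l.length < 3

lemma exists_fiber_branchQuartic (h2 : (2 : F) ≠ 0) (h3 : (3 : F) ≠ 0) {e : F} (he : e ≠ 0) {s : F}
    (hs : s ∈ squareSet (branchQuartic e)) :
    ∃ x₁ x₂ : F, x₁ ≠ x₂ ∧ x₁ ≠ 0 ∧ x₂ ≠ 0 ∧ x₁ ^ 2 + (3 * e - s ^ 2) * x₁ + 3 * e ^ 2 = 0 ∧
      x₂ ^ 2 + (3 * e - s ^ 2) * x₂ + 3 * e ^ 2 = 0 := by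
  obtain ⟨h0, r, hr⟩ := mem_squareSet.1 hs
  have hr0 : r ≠ 0 := by rintro rfl; simp [hr] at h0
  simp only [branchQuartic, eval_sub, eval_mul, eval_pow, eval_X, eval_C] at hr
  have q₁ : ((s ^ 2 - 3 * e + r) / 2) ^ 2 + (3 * e - s ^ 2) * ((s ^ 2 - 3 * e + r) / 2) +
      3 * e ^ 2 = 0 := by
    field_simp; linear_combination -hr
  have q₂ : ((s ^ 2 - 3 * e - r) / 2) ^ 2 + (3 * e - s ^ 2) * ((s ^ 2 - 3 * e - r) / 2) +
      3 * e ^ 2 = 0 := by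
    field_simp; linear_combination -hr
  have hne : 3 * e ^ 2 ≠ 0 := mul_ne_zero h3 (pow_ne_zero _ he)
  refine ⟨_, _, ?_, ?_, ?_, q₁, q₂⟩
  · intro h
    apply hr0
    field_simp at h
    refine mul_left_cancel₀ h2 ?_
    linear_combination h
  · intro h; rw [h] at q₁; exact hne (by linear_combination q₁)
  · intro h; rw [h] at q₂; exact hne (by linear_combination q₂)

lemma pow_four_mul_quartic_div {a b d f : F} (hb : b ≠ 0) :
    b ^ 4 * ((a / b) ^ 4 - d * (a / b) ^ 2 - f) = a ^ 4 - d * a ^ 2 * b ^ 2 - f * b ^ 4 := by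
  field_simp

/-- Restrictions coming from the plane sections invariant under `P ↦ T - P`, where `T = (e, 0)`. -/
lemma NoFourSecant.twoTorsion_cone (h2 : ringChar F ≠ 2) (h3 : (3 : F) ≠ 0)
    (hq : 9887 < Fintype.card F) {e q₀ q₁ q₂ q₃ : F} (he : e ≠ 0)
    (h : NoFourSecant e q₀ q₁ q₂ q₃) :
    (q₁ - e * q₀ ≠ 0 ∧ q₂ ^ 2 = (q₃ + e * q₁ + e ^ 2 * q₀) * (q₁ - e * q₀)) ∨
    (q₁ - e * q₀ ≠ 0 ∧ q₂ = 0 ∧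
      (q₃ + e * q₁ + e ^ 2 * q₀) ^ 2 = -3 * e ^ 2 * (q₁ - e * q₀) ^ 2) ∨
    (q₁ - e * q₀ = 0 ∧ q₃ + e * q₁ + e ^ 2 * q₀ = 0 ∧ q₂ ≠ 0) := by
  have two_ne : (2 : F) ≠ 0 := Ring.two_ne_zero h2
  set γ := q₁ - e * q₀ with hγ
  set α := q₃ + e * q₁ + e ^ 2 * q₀ with hα
  by_cases hdet : q₂ ^ 2 = α * γ
  · left
    refine ⟨?_, hdet⟩
    intro hγ0
    have hq2 : q₂ = 0 := by simpa [hγ0] using hdet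
    obtain ⟨t, ht, ht0⟩ := exists_mem_squareSet_notMem h2 hq (nonSq_branchQuartic two_ne h3 he)
      (natDegree_branchQuartic_le e) {0} (by simp)
    obtain ⟨x₁, x₂, hne, h1, h2, e1, e2⟩ := exists_fiber_branchQuartic two_ne h3 he ht
    have ht0 : t ≠ 0 := by simpa using ht0
    have := h.line (t * e) (-t) (neg_ne_zero.2 ht0) (by linear_combination hq2 - t * hγ0)
      [(e, 0), (x₁ + e, t * x₁), (x₂ + e, t * x₂)] (by simp [hne, h1, h2, ht0]) (by
        simp only [List.mem_cons, List.not_mem_nil, or_false, forall_eq_or_imp, forall_eq]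
        refine ⟨⟨by ring, by ring⟩, ⟨?_, by ring⟩, ?_, by ring⟩
        · linear_combination -x₁ * e1
        · linear_combination -x₂ * e2)
    simp at this
  right
  obtain ⟨c₃, hc₃⟩ : ∃ c, c = -4 * q₂ * (q₂ ^ 2 * α - 3 * e * q₂ ^ 2 * γ - 3 * e * α * γ ^ 2 - 3 * e ^ 2 * γ ^ 3) := ⟨_, rfl⟩
  obtain ⟨c₁, hc₁⟩ : ∃ c, c = -4 * q₂ * (α ^ 3 - 3 * e * α * q₂ ^ 2 - 3 * e * α ^ 2 * γ - 3 * e ^ 2 * γ * q₂ ^ 2) := ⟨_, rfl⟩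
  obtain ⟨c₄, hc₄⟩ : ∃ c, c = q₂ ^ 4 - 6 * e * q₂ ^ 2 * γ ^ 2 - 3 * e ^ 2 * γ ^ 4 := ⟨_, rfl⟩
  obtain ⟨c₂, hc₂⟩ : ∃ c, c = 6 * q₂ ^ 2 * α ^ 2 - 6 * e * (q₂ ^ 4 + 4 * α * q₂ ^ 2 * γ + α ^ 2 * γ ^ 2) -
        18 * e ^ 2 * γ ^ 2 * q₂ ^ 2 := ⟨_, rfl⟩
  obtain ⟨c₀, hc₀⟩ : ∃ c, c = α ^ 4 - 6 * e * α ^ 2 * q₂ ^ 2 - 3 * e ^ 2 * q₂ ^ 4 := ⟨_, rfl⟩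
  by_cases hns : NonSq (branchQuartic e *
      (C c₄ * X ^ 4 + C c₃ * X ^ 3 + C c₂ * X ^ 2 + C c₁ * X + C c₀))
  · exfalso
    obtain ⟨s, hs, t, ht, hst, hrel⟩ := exists_matched_squares h2 hq
      (nonSq_branchQuartic two_ne h3 he) (natDegree_branchQuartic_le e) (by compute_degree) hdet
      (by
        intro u hu
        simp only [branchQuartic, eval_sub, eval_mul, eval_pow, eval_X, eval_C, eval_add]
        rw [hc₀, hc₁, hc₂, hc₃, hc₄, pow_four_mul_quartic_div hu]
        ring) hns
    obtain ⟨x₁, x₂, hne, h1, h2, e1, e2⟩ := exists_fiber_branchQuartic two_ne h3 he hs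
    obtain ⟨y₁, y₂, hne', h1', h2', e1', e2'⟩ := exists_fiber_branchQuartic two_ne h3 he ht
    have hxy : ∀ {x y : F}, x ≠ 0 → x = y → s * x = t * y → False := by
      rintro x _ hx rfl h
      exact hst (mul_right_cancel₀ hx h)
    have := h.affine (e ^ 2 - s * t * e) (e + s * t) (-(s + t))
      (by rw [hα, hγ] at hrel; linear_combination hrel)
      [(x₁ + e, s * x₁), (x₂ + e, s * x₂), (y₁ + e, t * y₁), (y₂ + e, t * y₂)] (by
        simp only [List.nodup_cons, List.mem_cons, List.not_mem_nil, or_false, Prod.mk.injEq,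
          add_left_inj, not_or, not_and, List.nodup_nil, not_false_eq_true, and_true]
        exact ⟨⟨fun h => absurd h hne, hxy h1, hxy h1⟩, ⟨hxy h2, hxy h2⟩,
          fun h => absurd h hne'⟩) (by
        simp only [List.mem_cons, List.not_mem_nil, or_false, forall_eq_or_imp, forall_eq]
        refine ⟨⟨?_, ?_⟩, ⟨?_, ?_⟩, ⟨?_, ?_⟩, ?_, ?_⟩
        · linear_combination -x₁ * e1
        · linear_combination e1
        · linear_combination -x₂ * e2
        · linear_combination e2
        · linear_combination -y₁ * e1'
        · linear_combination e1'
        · linear_combination -y₂ * e2'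
        · linear_combination e2')
    simp at this
  · obtain ⟨g₃, g₁, g₂, g₀⟩ := coeffs_of_not_nonSq two_ne h3 he hns
    rw [hc₃] at g₃; rw [hc₁] at g₁; rw [hc₄, hc₂] at g₂; rw [hc₄, hc₀] at g₀
    exact involution_preserving_branchQuartic two_ne h3 he hdet g₃ g₁ g₂ g₀

/-- The branch cubic of the degree two map `x` on the curve `y² = x³ - e³`. -/
noncomputable def branchCubic (e : F) : F[X] := X ^ 3 - C (e ^ 3)

lemma natDegree_branchCubic_le (e : F) : (branchCubic e).natDegree ≤ 4 := by
  rw [branchCubic]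
  refine (natDegree_sub_le _ _).trans ?_
  simp

lemma eval_branchCubic (e x : F) : (branchCubic e).eval x = x ^ 3 - e ^ 3 := by
  simp [branchCubic]

lemma eval_derivative_branchCubic (e x : F) :
    (derivative (branchCubic e)).eval x = 3 * x ^ 2 := by
  simp only [branchCubic, derivative_sub, derivative_X_pow, derivative_C, eval_sub, eval_mul,
    eval_pow, eval_X, eval_C, eval_zero]
  norm_num

lemma nonSq_branchCubic (h3 : (3 : F) ≠ 0) {e : F} (he : e ≠ 0) : NonSq (branchCubic e) := by
  refine nonSq_of_simple_root e ?_ ?_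
  · rw [coe_aeval_eq_eval, eval_branchCubic, sub_self]
  · rw [coe_aeval_eq_eval, eval_derivative_branchCubic]
    exact mul_ne_zero h3 (pow_ne_zero 2 he)

lemma primitive_cube_root_facts (h3 : (3 : F) ≠ 0) {ω : F} (hω : ω ^ 2 + ω + 1 = 0) :
    ω ≠ 0 ∧ ω ≠ 1 ∧ ω ^ 2 ≠ 1 ∧ ω ≠ ω ^ 2 ∧ ω ^ 3 = 1 := by
  have h0 : ω ≠ 0 := by rintro rfl; simp at hω
  have h1 : ω ≠ 1 := by rintro rfl; exact h3 (by linear_combination hω)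
  refine ⟨h0, h1, ?_, ?_, by linear_combination (ω - 1) * hω⟩
  · intro h
    have h2 : ω = -2 := by linear_combination hω - h
    rw [h2] at hω
    exact h3 (by linear_combination hω)
  · intro h
    exact mul_ne_zero h0 (sub_ne_zero.2 h1) (by linear_combination -h)

/-- The involutions permuting the branch points of the map `x`. -/
lemma involution_preserving_branchCubic (h2 : (2 : F) ≠ 0) (h3 : (3 : F) ≠ 0) {ω : F}
    (hω : ω ^ 2 + ω + 1 = 0) {e : F} (he : e ≠ 0) {α β γ : F} (hdet : β ^ 2 ≠ α * γ)
    (h : ¬ NonSq (branchCubic e * ((C γ * X - C β) *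
      ((C β * X - C α) ^ 3 - C (e ^ 3) * (C γ * X - C β) ^ 3)))) :
    γ ≠ 0 ∧ ∃ x : F, x ^ 3 = e ^ 3 ∧ β = x * γ ∧ α = -2 * x ^ 2 * γ := by
  obtain ⟨hω0, hω1, hω2, hωω, hω3⟩ := primitive_cube_root_facts h3 hω
  have hω4 : ω ^ 4 = ω := by linear_combination ω * hω3
  have hroot : ∀ x : F, x ^ 3 = e ^ 3 →
      (γ * x - β) * ((β * x - α) ^ 3 - e ^ 3 * (γ * x - β) ^ 3) = 0 := by
    intro x hx
    by_contra hc
    refine h (nonSq_mul_of_simple_root x ?_ ?_ ?_)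
    · rw [coe_aeval_eq_eval, eval_branchCubic, hx, sub_self]
    · rw [coe_aeval_eq_eval, eval_derivative_branchCubic]
      refine mul_ne_zero h3 (pow_ne_zero 2 ?_)
      rintro rfl
      exact pow_ne_zero 3 he (by rw [← hx]; ring)
    · simpa [coe_aeval_eq_eval] using hc
  by_cases hγ : γ = 0
  · exfalso
    subst hγ
    have hβ : β ≠ 0 := by rintro rfl; simp at hdet
    have hr : ∀ x : F, x ^ 3 = e ^ 3 →
        2 * β ^ 3 * e ^ 3 - α ^ 3 - 3 * β ^ 2 * x ^ 2 * α + 3 * β * x * α ^ 2 = 0 := by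
      intro x hx
      have := hroot x hx
      refine (mul_eq_zero.1 (?_ : -β * _ = 0)).resolve_left (neg_ne_zero.2 hβ)
      linear_combination this + β ^ 4 * hx
    have r0 := hr e rfl
    have r1 := hr (ω * e) (by linear_combination e ^ 3 * hω3)
    have r2 := hr (ω ^ 2 * e) (by linear_combination (ω ^ 3 + 1) * e ^ 3 * hω3)
    have hα : α ^ 3 = 2 * β ^ 3 * e ^ 3 := by
      refine mul_left_cancel₀ h3 ?_
      linear_combination -r0 - r1 - r2 + 3 * β * e * α ^ 2 * hω - 3 * β ^ 2 * e ^ 2 * α * hω -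
        3 * β ^ 2 * e ^ 2 * α * hω4
    have hα0 : α ≠ 0 := by
      rintro rfl
      exact mul_ne_zero (mul_ne_zero h2 (pow_ne_zero 3 hβ)) (pow_ne_zero 3 he)
        (by linear_combination -hα)
    have key : ∀ x : F, x ≠ 0 → 2 * β ^ 3 * e ^ 3 - α ^ 3 - 3 * β ^ 2 * x ^ 2 * α +
        3 * β * x * α ^ 2 = 0 → α = β * x := by
      intro x hx hx'
      refine mul_left_cancel₀ (mul_ne_zero (mul_ne_zero h3 hβ) (mul_ne_zero hx hα0)) ?_
      linear_combination hx' + hα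
    have k0 := key e he r0
    have k1 := key (ω * e) (mul_ne_zero hω0 he) r1
    exact mul_ne_zero (mul_ne_zero hβ he) (sub_ne_zero.2 hω1) (by linear_combination k0 - k1)
  refine ⟨hγ, β / γ, ?_⟩
  have hx : (β / γ) ^ 3 = e ^ 3 := by
    by_contra hc
    rw [mul_comm] at h
    refine h (nonSq_mul_of_simple_root (β / γ) ?_ ?_ ?_)
    · have : γ * (β / γ) - β = 0 := by field_simp; ring
      simp [coe_aeval_eq_eval, this]
    · have h0 : γ * (β / γ) - β = 0 := by field_simp; ring
      have h1 : β * (β / γ) - α ≠ 0 := by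
        intro h
        field_simp at h
        exact hdet (by linear_combination h)
      rw [derivative_mul]
      simpa [coe_aeval_eq_eval, h0, hγ] using h1
    · rw [coe_aeval_eq_eval, eval_branchCubic]
      exact sub_ne_zero.2 hc
  obtain ⟨x, hxβ⟩ : ∃ x, x = β / γ := ⟨_, rfl⟩
  rw [← hxβ] at hx ⊢
  have hβ : β = x * γ := by rw [hxβ]; field_simp
  have hx0 : x ≠ 0 := by
    rintro rfl
    exact pow_ne_zero 3 he (by rw [← hx]; ring)
  refine ⟨hx, hβ, ?_⟩
  have r : ∀ w : F, w ≠ 1 → w ^ 3 = 1 →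
      -3 * γ ^ 2 * w ^ 2 * x ^ 4 * α + 3 * γ * w * x ^ 2 * α ^ 2 - α ^ 3 +
        3 * x ^ 6 * γ ^ 3 * w ^ 2 - 3 * x ^ 6 * γ ^ 3 * w + x ^ 6 * γ ^ 3 = 0 := by
    intro w hw hw3
    have := hroot (w * x) (by linear_combination x ^ 3 * hw3 + hx)
    rw [← hx, hβ] at this
    refine (mul_eq_zero.1 (?_ : (γ * x * (w - 1)) * _ = 0)).resolve_left
      (mul_ne_zero (mul_ne_zero hγ hx0) (sub_ne_zero.2 hw))
    linear_combination this
  have r1 := r ω hω1 hω3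
  have r2 := r (ω ^ 2) hω2 (by linear_combination (ω ^ 3 + 1) * hω3)
  refine mul_left_cancel₀ (mul_ne_zero (mul_ne_zero (mul_ne_zero h3 hγ) (pow_ne_zero 2 hx0))
    (mul_ne_zero (sub_ne_zero.2 hωω) (?_ : α - x ^ 2 * γ ≠ 0))) ?_
  · intro h
    apply hdet
    rw [hβ]
    linear_combination -γ * h
  · linear_combination r1 - r2 + (-3 * γ ^ 2 * x ^ 4 * α + 3 * x ^ 6 * γ ^ 3) * hω4

/-- Restrictions coming from the plane sections invariant under `P ↦ -P`. -/
lemma NoFourSecant.origin_cone (h2 : ringChar F ≠ 2) (h3 : (3 : F) ≠ 0)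
    (hq : 9887 < Fintype.card F) {ω : F} (hω : ω ^ 2 + ω + 1 = 0) {e q₀ q₁ q₂ q₃ : F} (he : e ≠ 0)
    (h : NoFourSecant e q₀ q₁ q₂ q₃) :
    (q₀ ≠ 0 ∧ ∃ u, q₁ = u * q₀ ∧ q₃ = u ^ 2 * q₀ ∧ u ∉ squareSet (branchCubic e)) ∨
    (q₀ ≠ 0 ∧ ∃ x, x ^ 3 = e ^ 3 ∧ q₁ = x * q₀ ∧ q₃ = -2 * x ^ 2 * q₀) ∨
    (q₀ = 0 ∧ q₁ = 0 ∧ q₃ ≠ 0) := by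
  have two_ne : (2 : F) ≠ 0 := Ring.two_ne_zero h2
  have hB := nonSq_branchCubic h3 he
  have hm := natDegree_branchCubic_le e
  have pair : ∀ s ∈ squareSet (branchCubic e), ∀ t ∈ squareSet (branchCubic e), s ≠ t →
      q₃ - q₁ * (s + t) + q₀ * s * t ≠ 0 := by
    intro s hs t ht hst hrel
    obtain ⟨hs0, y, hy⟩ := mem_squareSet.1 hs
    obtain ⟨ht0, z, hz⟩ := mem_squareSet.1 ht
    have hy0 : y ≠ -y := by
      intro h
      have h : y = 0 := mul_left_cancel₀ two_ne (by linear_combination h)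
      simp [hy, h] at hs0
    have hz0 : z ≠ -z := by
      intro h
      have h : z = 0 := mul_left_cancel₀ two_ne (by linear_combination h)
      simp [hz, h] at ht0
    rw [eval_branchCubic] at hy hz
    have := h.affine (s * t) (-(s + t)) 0 (by linear_combination hrel)
      [(s, y), (s, -y), (t, z), (t, -z)] (by simp [hst, hy0, hz0]) (by
        simp only [List.mem_cons, List.not_mem_nil, or_false, forall_eq_or_imp, forall_eq]
        refine ⟨⟨?_, by ring⟩, ⟨?_, by ring⟩, ⟨?_, by ring⟩, ?_, by ring⟩
        · linear_combination -hy
        · linear_combination -hy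
        · linear_combination -hz
        · linear_combination -hz)
    simp at this
  obtain ⟨v, hv, -⟩ := exists_mem_squareSet_notMem h2 hq hB hm ∅ (by simp)
  by_cases hdet : q₁ ^ 2 = q₃ * q₀
  · by_cases h0 : q₀ = 0
    · have h1 : q₁ = 0 := by simpa [h0] using hdet
      refine Or.inr (Or.inr ⟨h0, h1, fun h3 => ?_⟩)
      obtain ⟨t, ht, htv⟩ := exists_mem_squareSet_notMem h2 hq hB hm {v} (by simp)
      exact pair t ht v hv (by simpa using htv) (by simp [h0, h1, h3])
    · have h1 : q₁ = q₁ / q₀ * q₀ := by field_simp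
      obtain ⟨u, hu⟩ : ∃ u, u = q₁ / q₀ := ⟨_, rfl⟩
      rw [← hu] at h1
      have h3 : q₃ = u ^ 2 * q₀ := by
        refine mul_right_cancel₀ h0 ?_
        rw [← hdet, h1]; ring
      refine Or.inl ⟨h0, u, h1, h3, fun hus => ?_⟩
      obtain ⟨t, ht, htv⟩ := exists_mem_squareSet_notMem h2 hq hB hm {u} (by simp)
      exact pair t ht u hus (by simpa using htv) (by rw [h1, h3]; ring)
  refine Or.inr (Or.inl ?_)
  refine involution_preserving_branchCubic two_ne h3 hω he hdet fun hns => ?_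
  obtain ⟨s, hs, t, ht, hst, hrel⟩ := exists_matched_squares h2 hq hB hm (by compute_degree) hdet
    (by
      intro u hu
      simp only [eval_branchCubic, eval_sub, eval_mul, eval_pow, eval_X, eval_C]
      field_simp) hns
  exact pair s hs t ht hst hrel

lemma NoFourSecant.congr {e e' q₀ q₁ q₂ q₃ : F} (hee : e' ^ 3 = e ^ 3)
    (h : NoFourSecant e q₀ q₁ q₂ q₃) : NoFourSecant e' q₀ q₁ q₂ q₃ := by
  obtain ⟨h1, h2⟩ := h
  rw [← hee] at h1 h2
  exact ⟨h1, h2⟩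

lemma not_noFourSecant (h2 : ringChar F ≠ 2) (h3 : (3 : F) ≠ 0)
    (hq : 9887 < Fintype.card F) {ω : F} (hω : ω ^ 2 + ω + 1 = 0) {e q₀ q₁ q₂ q₃ : F} (he : e ≠ 0) :
    ¬ NoFourSecant e q₀ q₁ q₂ q₃ := by
  intro h
  have two_ne : (2 : F) ≠ 0 := Ring.two_ne_zero h2
  obtain ⟨hω0, hω1, hω2, hωω, hω3⟩ := primitive_cube_root_facts h3 hω
  have hω4 : ω ^ 4 = ω := by linear_combination ω * hω3
  have cone : ∀ x, x ^ 3 = e ^ 3 → _ := fun x hx => NoFourSecant.twoTorsion_cone h2 h3 hq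
    (by rintro rfl; exact pow_ne_zero 3 he (by rw [← hx]; ring)) (h.congr hx)
  obtain ⟨h0, u, rfl, rfl, hu⟩ | ⟨h0, x, hx, rfl, rfl⟩ | ⟨rfl, rfl, h3'⟩ :=
    h.origin_cone h2 h3 hq hω he
  · have hue : ∀ x, x ^ 3 = e ^ 3 → u ≠ x := by
      rintro x hx rfl
      have hu0 : u ≠ 0 := by rintro rfl; exact pow_ne_zero 3 he (by rw [← hx]; ring)
      obtain ⟨h, -⟩ | ⟨h, -⟩ | ⟨-, h, -⟩ := cone u hx
      · exact h (by ring)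
      · exact h (by ring)
      · exact mul_ne_zero (mul_ne_zero h3 (pow_ne_zero 2 hu0)) h0 (by linear_combination h)
    have hX : ∀ x, x ^ 3 = e ^ 3 → (u ^ 2 + x * u + x ^ 2) ^ 2 = -3 * x ^ 2 * (u - x) ^ 2 := by
      intro x hx
      obtain ⟨-, h⟩ | ⟨-, -, h⟩ | ⟨h, -⟩ := cone x hx
      · exfalso
        apply hu
        have hsq : u ^ 3 - e ^ 3 = (q₂ / q₀) * (q₂ / q₀) := by
          field_simp
          linear_combination -h + q₀ ^ 2 * hx
        rw [mem_squareSet, eval_branchCubic]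
        refine ⟨?_, _, hsq⟩
        intro h'
        have hprod : (u - e) * (u - ω * e) * (u - ω ^ 2 * e) = 0 := by
          linear_combination h' + (-(u ^ 2) * e + u * e ^ 2 * ω) * hω - e ^ 3 * hω3
        rcases mul_eq_zero.1 hprod with h' | h'
        · rcases mul_eq_zero.1 h' with h' | h'
          · exact hue e rfl (sub_eq_zero.1 h')
          · exact hue (ω * e) (by linear_combination e ^ 3 * hω3) (sub_eq_zero.1 h')
        · exact hue (ω ^ 2 * e) (by linear_combination (ω ^ 3 + 1) * e ^ 3 * hω3)
            (sub_eq_zero.1 h')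
      · refine mul_left_cancel₀ (pow_ne_zero 2 h0) ?_
        linear_combination h
      · exact absurd (mul_right_cancel₀ h0 (sub_eq_zero.1 h)) (hue x hx)
    have hfac : ∀ x, x ^ 3 = e ^ 3 → (u ^ 2 - 2 * (ω * x) * u - 2 * (ω * x) ^ 2) *
        (u ^ 2 - 2 * (ω ^ 2 * x) * u - 2 * (ω ^ 2 * x) ^ 2) = 0 := by
      intro x hx
      linear_combination hX x hx + (-2 * x * u ^ 3 - 2 * x ^ 2 * u ^ 2 + 4 * x ^ 3 * u) * hω +
        (4 * x ^ 2 * u ^ 2 + 4 * x ^ 4) * hω3 +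
        (4 * x ^ 3 * u - 2 * x ^ 2 * (u ^ 2 - 2 * ω * x * u - 2 * ω ^ 2 * x ^ 2)) * hω4
    have hpair : ∀ a b c, a ≠ b → a + b + c = 0 → c ^ 3 = e ^ 3 →
        u ^ 2 - 2 * a * u - 2 * a ^ 2 = 0 → u ^ 2 - 2 * b * u - 2 * b ^ 2 = 0 → False := by
      intro a b c hab habc hc ha hb
      refine hue c hc (mul_left_cancel₀ (mul_ne_zero two_ne (sub_ne_zero.2 hab)) ?_)
      linear_combination hb - ha - 2 * (a - b) * habc
    have c1 : (ω * e) ^ 3 = e ^ 3 := by linear_combination e ^ 3 * hω3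
    have c2 : (ω ^ 2 * e) ^ 3 = e ^ 3 := by linear_combination (ω ^ 3 + 1) * e ^ 3 * hω3
    have f0 := hfac e rfl
    have f1 := hfac (ω * e) c1
    have f2 := hfac (ω ^ 2 * e) c2
    rw [show ω * (ω * e) = ω ^ 2 * e by ring,
      show ω ^ 2 * (ω * e) = e by linear_combination e * hω3] at f1
    rw [show ω * (ω ^ 2 * e) = e by linear_combination e * hω3,
      show ω ^ 2 * (ω ^ 2 * e) = ω * e by linear_combination e * hω4] at f2
    have n1 : ω * e ≠ e := fun h => hω1 (mul_right_cancel₀ he (by rw [h, one_mul]))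
    have n2 : ω ^ 2 * e ≠ e := fun h => hω2 (mul_right_cancel₀ he (by rw [h, one_mul]))
    have n3 : ω * e ≠ ω ^ 2 * e := fun h => hωω (mul_right_cancel₀ he h)
    have k1 := hpair (ω * e) (ω ^ 2 * e) e n3 (by linear_combination e * hω) rfl
    have k2 := hpair (ω * e) e (ω ^ 2 * e) n1 (by linear_combination e * hω) c2
    have k3 := hpair (ω ^ 2 * e) e (ω * e) n2 (by linear_combination e * hω) c1
    rw [mul_eq_zero] at f0 f1 f2
    tauto
  · have hx0 : x ≠ 0 := by rintro rfl; exact pow_ne_zero 3 he (by rw [← hx]; ring)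
    have hc : ∀ w : F, w ≠ 1 → w ^ 3 = 1 → q₂ ≠ 0 → q₂ ^ 2 = -3 * x ^ 3 * (1 - w) * q₀ ^ 2 := by
      intro w hw hw3 hq2
      have hw' : w ^ 2 + w + 1 = 0 :=
        mul_left_cancel₀ (sub_ne_zero.2 hw) (by linear_combination hw3)
      obtain ⟨-, h⟩ | ⟨-, h, -⟩ | ⟨h, -⟩ := cone (w * x) (by linear_combination x ^ 3 * hw3 + hx)
      · linear_combination h + x ^ 3 * q₀ ^ 2 * (1 - w) * hw'
      · exact absurd h hq2
      · exact absurd (by linear_combination h)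
          (mul_ne_zero (mul_ne_zero hx0 (sub_ne_zero.2 hw.symm)) h0)
    have hq2 : q₂ ≠ 0 := by
      obtain ⟨h, -⟩ | ⟨h, -⟩ | ⟨-, -, h⟩ := cone x hx
      · exact absurd (by ring) h
      · exact absurd (by ring) h
      · exact h
    have e1 := hc ω hω1 hω3 hq2
    have e2 := hc (ω ^ 2) hω2 (by linear_combination (ω ^ 3 + 1) * hω3) hq2
    exact mul_ne_zero (mul_ne_zero (mul_ne_zero h3 (pow_ne_zero 3 hx0)) (pow_ne_zero 2 h0))
      (sub_ne_zero.2 hωω) (by linear_combination e2 - e1)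
  · obtain ⟨h, -⟩ | ⟨h, -⟩ | ⟨-, h, -⟩ := cone e rfl
    · exact h (by ring)
    · exact h (by ring)
    · exact h3' (by linear_combination h)

lemma exists_functional_of_isHExtendable_two {n : ℕ} {C : Submodule F (Fin n → F)}
    (h : IsHExtendable 2 C) :
    ∃ Q : C →ₗ[F] F, ∀ x : C, x ≠ 0 → Q x = 0 →
      minDist C + 1 ≤ hammingNorm (x : Fin n → F) := by
  obtain ⟨C', hrank, hdist, hmap⟩ := h
  have hmem : ∀ x : C', LinearMap.funLeft F F (Fin.castAdd 2) x ∈ C := by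
    intro x
    rw [← hmap]
    exact Submodule.mem_map_of_mem x.2
  let f : C' →ₗ[F] C := ((LinearMap.funLeft F F (Fin.castAdd 2)).comp C'.subtype).codRestrict C hmem
  have hsurj : Function.Surjective f := by
    rintro ⟨y, hy⟩
    have hy' := hy
    rw [← hmap] at hy'
    obtain ⟨x, hx, hxy⟩ := hy'
    exact ⟨⟨x, hx⟩, Subtype.ext hxy⟩
  have hinj : Function.Injective f :=
    (LinearMap.injective_iff_surjective_of_finrank_eq_finrank hrank).2 hsurj
  let g : C' ≃ₗ[F] C := LinearEquiv.ofBijective f ⟨hinj, hsurj⟩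
  refine ⟨(LinearMap.proj (Fin.natAdd n (0 : Fin 2))).comp (C'.subtype.comp g.symm.toLinearMap),
    fun x hx hQ => ?_⟩
  obtain ⟨z, rfl⟩ := g.surjective x
  have hz : z ≠ 0 := by rintro rfl; simp at hx
  have hz0 : (z : Fin (n + 2) → F) (Fin.natAdd n (0 : Fin 2)) = 0 := by simpa using hQ
  have hle : minDist C' ≤ hammingNorm (z : Fin (n + 2) → F) :=
    Nat.sInf_le ⟨z, z.2, by simpa using hz, rfl⟩
  have hnorm : hammingNorm (z : Fin (n + 2) → F) ≤ hammingNorm ((g z : C) : Fin n → F) + 1 := by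
    have hg : ∀ i, ((g z : C) : Fin n → F) i = (z : Fin (n + 2) → F) (Fin.castAdd 2 i) :=
      fun i => rfl
    simp only [hammingNorm, Finset.card_filter, hg]
    rw [Fin.sum_univ_add, Fin.sum_univ_two, hz0]
    gcongr
    split_ifs <;> simp_all
  omega

/-- The coordinates of a rational point on the short Weierstrass model; the point at infinity is
sent to `none`. -/
def shortCoord (W : WeierstrassCurve F) : W.toAffine.Point → Option (F × F)
  | .zero => none
  | .some (x := x) (y := y) _ => some (x + W.b₂ / 12, y + (W.a₁ * x + W.a₃) / 2)

lemma shortCoord_injective (W : WeierstrassCurve F) : Function.Injective (shortCoord W) := by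
  intro P Q h
  cases P with
  | zero =>
    cases Q with
    | zero => rfl
    | some _ => simp [shortCoord] at h
  | some _ =>
    cases Q with
    | zero => simp [shortCoord] at h
    | some _ =>
      simp only [shortCoord, Option.some.injEq, Prod.mk.injEq, add_left_inj] at h
      obtain ⟨rfl, h⟩ := h
      simp only [add_left_inj] at h
      subst h
      rfl

lemma equation_iff_short (h2 : (2 : F) ≠ 0) (h3 : (3 : F) ≠ 0) {W : WeierstrassCurve F}
    (hc : W.c₄ = 0) (x y : F) : W.toAffine.Equation x y ↔
      (y + (W.a₁ * x + W.a₃) / 2) ^ 2 = (x + W.b₂ / 12) ^ 3 - W.c₆ / 864 := by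
  have key : (y + (W.a₁ * x + W.a₃) / 2) ^ 2 - ((x + W.b₂ / 12) ^ 3 - W.c₄ / 48 * (x + W.b₂ / 12)
      - W.c₆ / 864) = y ^ 2 + W.a₁ * x * y + W.a₃ * y - (x ^ 3 + W.a₂ * x ^ 2 + W.a₄ * x + W.a₆) := by
    simp only [WeierstrassCurve.c₄, WeierstrassCurve.c₆, WeierstrassCurve.b₂, WeierstrassCurve.b₄,
      WeierstrassCurve.b₆]
    rw [show (12 : F) = 2 ^ 2 * 3 by norm_num, show (48 : F) = 2 ^ 4 * 3 by norm_num,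
      show (864 : F) = 2 ^ 5 * 3 ^ 3 by norm_num]
    field_simp
    ring
  rw [hc] at key
  rw [Affine.equation_iff]
  constructor
  · intro h
    linear_combination key + h
  · intro h
    linear_combination -key + h

lemma shortCoord_eq_some (h2 : (2 : F) ≠ 0) (h3 : (3 : F) ≠ 0) {W : WeierstrassCurve F}
    (hc : W.c₄ = 0) {P : W.toAffine.Point} {X Y : F} (h : shortCoord W P = some (X, Y)) :
    Y ^ 2 = X ^ 3 - W.c₆ / 864 := by
  cases P with
  | zero => simp [shortCoord] at h
  | some _ _ hP =>
    simp only [shortCoord, Option.some.injEq, Prod.mk.injEq] at h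
    obtain ⟨rfl, rfl⟩ := h
    exact (equation_iff_short h2 h3 hc _ _).1 hP.1

lemma exists_shortCoord_eq (h2 : (2 : F) ≠ 0) (h3 : (3 : F) ≠ 0) {W : WeierstrassCurve F}
    [W.IsElliptic] (hc : W.c₄ = 0) {X Y : F} (h : Y ^ 2 = X ^ 3 - W.c₆ / 864) :
    ∃ P, shortCoord W P = some (X, Y) := by
  have heq : W.toAffine.Equation (X - W.b₂ / 12)
      (Y - (W.a₁ * (X - W.b₂ / 12) + W.a₃) / 2) := by
    rw [equation_iff_short h2 h3 hc]
    simpa using h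
  exact ⟨.some _ _ (Affine.equation_iff_nonsingular.1 heq), by simp [shortCoord]⟩

/-- The values of `1, X, Y, X²` at a point of the short model. -/
def planeVec : Option (F × F) → Fin 4 → F
  | none => ![0, 0, 0, 1]
  | some (X, Y) => ![1, X, Y, X ^ 2]

lemma ellipticCode_four_eq (W : WeierstrassCurve F)
    {n : ℕ} (e : Fin n ≃ W.toAffine.Point) : ellipticCode W 4 e =
      Submodule.span F (Set.range fun i : Fin 4 => fun j => planeVec (shortCoord W (e j)) i) := by
  obtain ⟨r, hr⟩ : ∃ r : Fin 4 → Fin n → F, r = fun i j => phiVec W 4 (e j) i := ⟨_, rfl⟩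
  obtain ⟨s, hs⟩ : ∃ s : Fin 4 → Fin n → F,
    s = fun i j => planeVec (shortCoord W (e j)) i := ⟨_, rfl⟩
  obtain ⟨k, hk⟩ : ∃ k, k = W.b₂ / 12 := ⟨_, rfl⟩
  have h0 : s 0 = r 0 := by
    ext j
    simp only [hr, hs]
    cases e j <;> simp [phiVec, planeVec, shortCoord]
  have h1 : s 1 = r 1 + k • r 0 := by
    ext j
    simp only [hr, hs, hk, Pi.add_apply, Pi.smul_apply]
    cases e j <;> simp [phiVec, planeVec, shortCoord, psi]
  have h2' : s 2 = r 2 + (W.a₁ / 2) • r 1 + (W.a₃ / 2) • r 0 := by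
    ext j
    simp only [hr, hs, Pi.add_apply, Pi.smul_apply]
    cases e j <;> simp [phiVec, planeVec, shortCoord, psi]
    ring
  have h3 : s 3 = r 3 + (2 * k) • r 1 + (k ^ 2) • r 0 := by
    ext j
    simp only [hr, hs, hk, Pi.add_apply, Pi.smul_apply]
    cases e j <;> simp [phiVec, planeVec, shortCoord, psi]
    ring
  rw [ellipticCode, ← hr, ← hs]
  have hsS : ∀ i, s i ∈ Submodule.span F (Set.range s) := fun i =>
    Submodule.subset_span ⟨i, rfl⟩
  have hrS : ∀ i, r i ∈ Submodule.span F (Set.range r) := fun i =>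
    Submodule.subset_span ⟨i, rfl⟩
  have g0 : r 0 ∈ Submodule.span F (Set.range s) := h0 ▸ hsS 0
  have g1 : r 1 ∈ Submodule.span F (Set.range s) := by
    rw [show r 1 = s 1 - k • r 0 by rw [h1]; simp]
    exact sub_mem (hsS 1) (Submodule.smul_mem _ _ g0)
  apply le_antisymm <;> rw [Submodule.span_le, Set.range_subset_iff]
  · refine Fin.forall_fin_succ.2 ⟨g0, Fin.forall_fin_succ.2 ⟨g1, Fin.forall_fin_two.2 ⟨?_, ?_⟩⟩⟩
    · change r 2 ∈ _
      rw [show r 2 = s 2 - (W.a₁ / 2) • r 1 - (W.a₃ / 2) • r 0 by rw [h2']; module]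
      exact sub_mem (sub_mem (hsS 2) (Submodule.smul_mem _ _ g1)) (Submodule.smul_mem _ _ g0)
    · change r 3 ∈ _
      rw [show r 3 = s 3 - (2 * k) • r 1 - (k ^ 2) • r 0 by rw [h3]; module]
      exact sub_mem (sub_mem (hsS 3) (Submodule.smul_mem _ _ g1)) (Submodule.smul_mem _ _ g0)
  · refine Fin.forall_fin_succ.2 ⟨?_, Fin.forall_fin_succ.2 ⟨?_, Fin.forall_fin_two.2 ⟨?_, ?_⟩⟩⟩
    · exact h0 ▸ hrS 0
    · change s 1 ∈ _
      rw [h1]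
      exact add_mem (hrS 1) (Submodule.smul_mem _ _ (hrS 0))
    · change s 2 ∈ _
      rw [h2']
      exact add_mem (add_mem (hrS 2) (Submodule.smul_mem _ _ (hrS 1)))
        (Submodule.smul_mem _ _ (hrS 0))
    · change s 3 ∈ _
      rw [h3]
      exact add_mem (add_mem (hrS 3) (Submodule.smul_mem _ _ (hrS 1)))
        (Submodule.smul_mem _ _ (hrS 0))

lemma card_le_natDegree_of_eval_eq_zero {p : F[X]} (hp : p ≠ 0) {S : Finset F}
    (h : ∀ x ∈ S, p.eval x = 0) : S.card ≤ p.natDegree := by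
  refine card_le_degree_of_subset_roots fun x hx => ?_
  rw [mem_roots hp]
  exact h x hx

/-- A plane section of the affine curve `y² = x³ - c` has at most four points, and a line section
at most three. -/
lemma card_planeSection_le {c b₀ b₁ b₂ b₃ : F} (hb : b₀ ≠ 0 ∨ b₁ ≠ 0 ∨ b₂ ≠ 0 ∨ b₃ ≠ 0)
    {T : Finset (F × F)} (hT : ∀ P ∈ T, P.2 ^ 2 = P.1 ^ 3 - c ∧
      b₀ + b₁ * P.1 + b₂ * P.2 + b₃ * P.1 ^ 2 = 0) :
    T.card ≤ 4 ∧ (b₃ = 0 → T.card ≤ 3) := by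
  by_cases h2 : b₂ = 0
  · subst h2
    obtain ⟨p, hp⟩ : ∃ p : F[X], p = C b₃ * X ^ 2 + C b₁ * X + C b₀ := ⟨_, rfl⟩
    have hp0 : p ≠ 0 := by
      intro h0
      have c0 := congrArg (fun f : F[X] => f.coeff 0) (hp.symm.trans h0)
      have c1 := congrArg (fun f : F[X] => f.coeff 1) (hp.symm.trans h0)
      have c2 := congrArg (fun f : F[X] => f.coeff 2) (hp.symm.trans h0)
      simp [coeff_X, coeff_C] at c0 c1 c2
      simp [c0, c1, c2] at hb
    have hfib : ∀ x ∈ T.image Prod.fst, (T.filter fun P => P.1 = x).card ≤ 2 := by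
      intro x _
      have hq0 : (X ^ 2 - C (x ^ 3 - c)).natDegree = 2 := natDegree_X_pow_sub_C
      rw [← hq0, ← Finset.card_image_of_injOn (f := Prod.snd)]
      · refine card_le_natDegree_of_eval_eq_zero (X_pow_sub_C_ne_zero two_pos _) ?_
        intro y hy
        simp only [Finset.mem_image, Finset.mem_filter] at hy
        obtain ⟨P, ⟨hP, rfl⟩, rfl⟩ := hy
        simp [(hT P hP).1]
      · intro P hP Q hQ hPQ
        simp only [Finset.coe_filter, Set.mem_ofPred_eq] at hP hQ
        exact Prod.ext (hP.2.trans hQ.2.symm) hPQ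
    have hcard := Finset.card_le_mul_card_image T 2 hfib
    have himg : (T.image Prod.fst).card ≤ p.natDegree := by
      refine card_le_natDegree_of_eval_eq_zero hp0 ?_
      intro x hx
      obtain ⟨P, hP, rfl⟩ := Finset.mem_image.1 hx
      simp only [hp, eval_add, eval_mul, eval_pow, eval_X, eval_C]
      linear_combination (hT P hP).2
    refine ⟨?_, ?_⟩
    · have : p.natDegree ≤ 2 := by rw [hp]; compute_degree
      omega
    · rintro rfl
      have : p.natDegree ≤ 1 := by
        rw [hp]; simp only [map_zero, zero_mul, zero_add]; compute_degree
      omega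
  · have hinj : Set.InjOn Prod.fst (T : Set (F × F)) := by
      intro P hP Q hQ hPQ
      refine Prod.ext hPQ (mul_left_cancel₀ h2 ?_)
      have e1 := (hT P hP).2
      have e2 := (hT Q hQ).2
      rw [hPQ] at e1
      linear_combination e1 - e2
    obtain ⟨p, hp⟩ : ∃ p : F[X], p = C (b₃ ^ 2) * X ^ 4 + C (2 * b₁ * b₃ - b₂ ^ 2) * X ^ 3 +
        C (b₁ ^ 2 + 2 * b₀ * b₃) * X ^ 2 + C (2 * b₀ * b₁) * X + C (b₀ ^ 2 + b₂ ^ 2 * c) := ⟨_, rfl⟩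
    have hp0 : p ≠ 0 := by
      intro h0
      have c3 := congrArg (fun f : F[X] => f.coeff 3) (hp.symm.trans h0)
      have c4 := congrArg (fun f : F[X] => f.coeff 4) (hp.symm.trans h0)
      simp only [coeff_add, coeff_C_mul, coeff_X_pow, coeff_X, coeff_C, coeff_zero] at c3 c4
      norm_num at c3 c4
      simp [c4, h2] at c3
    rw [← Finset.card_image_of_injOn hinj]
    have himg : (T.image Prod.fst).card ≤ p.natDegree := by
      refine card_le_natDegree_of_eval_eq_zero hp0 ?_
      intro x hx
      obtain ⟨P, hP, rfl⟩ := Finset.mem_image.1 hx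
      obtain ⟨e1, e2⟩ := hT P hP
      simp only [hp, eval_add, eval_mul, eval_pow, eval_X, eval_C]
      linear_combination (b₀ + b₁ * P.1 - b₂ * P.2 + b₃ * P.1 ^ 2) * e2 + b₂ ^ 2 * e1
    refine ⟨?_, ?_⟩
    · have : p.natDegree ≤ 4 := by rw [hp]; compute_degree
      omega
    · rintro rfl
      have : p.natDegree ≤ 3 := by
        rw [hp]
        simp only [ne_eq, OfNat.ofNat_ne_zero, not_false_eq_true, zero_pow, map_zero, zero_mul,
          zero_add]
        compute_degree
      omega

/-- The codeword with coefficients `b` on the rows `1, X, Y, X²`. -/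
def planeWord (W : WeierstrassCurve F) {n : ℕ} (e : Fin n ≃ W.toAffine.Point) (b : Fin 4 → F) :
    Fin n → F :=
  ∑ i, b i • fun j => planeVec (shortCoord W (e j)) i

lemma mem_ellipticCode_four {W : WeierstrassCurve F} {n : ℕ} {e : Fin n ≃ W.toAffine.Point}
    {x : Fin n → F} : x ∈ ellipticCode W 4 e ↔ ∃ b, planeWord W e b = x := by
  rw [ellipticCode_four_eq, Submodule.mem_span_range_iff_exists_fun]
  rfl

lemma planeWord_eq_of_none {W : WeierstrassCurve F} {n : ℕ} {e : Fin n ≃ W.toAffine.Point}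
    {b : Fin 4 → F} {j : Fin n} (h : shortCoord W (e j) = none) : planeWord W e b j = b 3 := by
  simp [planeWord, Fin.sum_univ_four, h, planeVec]

lemma planeWord_eq_of_some {W : WeierstrassCurve F} {n : ℕ} {e : Fin n ≃ W.toAffine.Point}
    {b : Fin 4 → F} {j : Fin n} {P : F × F} (h : shortCoord W (e j) = some P) :
    planeWord W e b j = b 0 + b 1 * P.1 + b 2 * P.2 + b 3 * P.1 ^ 2 := by
  simp [planeWord, Fin.sum_univ_four, h, planeVec]

lemma exists_shortCoord_eq_none (W : WeierstrassCurve F) {n : ℕ} (e : Fin n ≃ W.toAffine.Point) :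
    ∃ j, shortCoord W (e j) = none :=
  ⟨e.symm .zero, by simp [shortCoord]⟩

lemma hammingNorm_add_card_zeros {n : ℕ} (x : Fin n → F) :
    hammingNorm x + (Finset.univ.filter fun j => x j = 0).card = n := by
  have := Finset.card_filter_add_card_filter_not (s := Finset.univ) fun j => x j = 0
  rw [Finset.card_univ, Fintype.card_fin] at this
  simp only [hammingNorm, ne_eq]
  omega

lemma le_minDist_ellipticCode_four (h2 : (2 : F) ≠ 0) (h3 : (3 : F) ≠ 0) {W : WeierstrassCurve F}
    (hc : W.c₄ = 0) {n : ℕ} (e : Fin n ≃ W.toAffine.Point) :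
    n ≤ minDist (ellipticCode W 4 e) + 4 := by
  have hne : {d | ∃ x ∈ ellipticCode W 4 e, x ≠ 0 ∧ hammingNorm x = d}.Nonempty := by
    obtain ⟨j, hj⟩ := exists_shortCoord_eq_none W e
    refine ⟨_, planeWord W e ![0, 0, 0, 1], mem_ellipticCode_four.2 ⟨_, rfl⟩, fun h => ?_, rfl⟩
    have := congrFun h j
    rw [planeWord_eq_of_none hj] at this
    simp at this
  obtain ⟨x, hx, hx0, hd⟩ := Nat.sInf_mem hne
  rw [minDist, ← hd]
  obtain ⟨b, rfl⟩ := mem_ellipticCode_four.1 hx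
  have hb : b 0 ≠ 0 ∨ b 1 ≠ 0 ∨ b 2 ≠ 0 ∨ b 3 ≠ 0 := by
    by_contra! hcon
    apply hx0
    simp [planeWord, Fin.sum_univ_four, hcon]
  obtain ⟨Z, hZ⟩ : ∃ Z, Z = Finset.univ.filter fun j => planeWord W e b j = 0 := ⟨_, rfl⟩
  have hsum := hammingNorm_add_card_zeros (planeWord W e b)
  rw [← hZ] at hsum
  suffices Z.card ≤ 4 by omega
  have hinj : Function.Injective fun j => shortCoord W (e j) :=
    (shortCoord_injective W).comp e.injective
  rw [← Finset.card_image_of_injective Z hinj]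
  obtain ⟨S, hS⟩ : ∃ S, S = Z.image fun j => shortCoord W (e j) := ⟨_, rfl⟩
  rw [← hS]
  have hT : ∀ P ∈ S.eraseNone, P.2 ^ 2 = P.1 ^ 3 - W.c₆ / 864 ∧
      b 0 + b 1 * P.1 + b 2 * P.2 + b 3 * P.1 ^ 2 = 0 := by
    rintro ⟨X, Y⟩ hP
    rw [Finset.mem_eraseNone, hS] at hP
    obtain ⟨j, hj, hjP⟩ := Finset.mem_image.1 hP
    refine ⟨shortCoord_eq_some h2 h3 hc hjP, ?_⟩
    rw [← planeWord_eq_of_some (e := e) hjP]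
    simpa [hZ] using hj
  obtain ⟨h4, h3'⟩ := card_planeSection_le hb hT
  have hcard := Finset.card_eraseNone_eq_card_erase S
  by_cases hnone : none ∈ S
  · have hb3 : b 3 = 0 := by
      rw [hS] at hnone
      obtain ⟨j, hj, hjP⟩ := Finset.mem_image.1 hnone
      rw [← planeWord_eq_of_none (e := e) (b := b) hjP]
      simpa [hZ] using hj
    have := Finset.card_erase_add_one hnone
    have := h3' hb3
    omega
  · rw [Finset.erase_eq_of_notMem hnone] at hcard
    omega

lemma exists_noFourSecant_of_isHExtendable (h2 : (2 : F) ≠ 0) (h3 : (3 : F) ≠ 0)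
    {ω : F} (hω : ω ^ 2 + ω + 1 = 0) {W : WeierstrassCurve F}
    [W.IsElliptic] (hc : W.c₄ = 0) {ε : F} (hε : ε ≠ 0) (hεc : ε ^ 3 = W.c₆ / 864) {n : ℕ}
    {e : Fin n ≃ W.toAffine.Point} (h : IsHExtendable 2 (ellipticCode W 4 e)) :
    ∃ q₀ q₁ q₂ q₃, NoFourSecant ε q₀ q₁ q₂ q₃ := by
  obtain ⟨hω0, hω1, hω2, hωω, hω3⟩ := primitive_cube_root_facts h3 hω
  obtain ⟨Q, hQ⟩ := exists_functional_of_isHExtendable_two h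
  have hmin := le_minDist_ellipticCode_four h2 h3 hc e
  have hrow : ∀ i, (fun j => planeVec (shortCoord W (e j)) i) ∈ ellipticCode W 4 e := fun i => by
    rw [ellipticCode_four_eq]
    exact Submodule.subset_span ⟨i, rfl⟩
  let q : Fin 4 → F := fun i => Q ⟨_, hrow i⟩
  have hword : ∀ b, planeWord W e b ∈ ellipticCode W 4 e := fun b =>
    mem_ellipticCode_four.2 ⟨b, rfl⟩
  have hQword : ∀ b, Q ⟨_, hword b⟩ = b 0 * q 0 + b 1 * q 1 + b 2 * q 2 + b 3 * q 3 := by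
    intro b
    have : (⟨_, hword b⟩ : ellipticCode W 4 e) = ∑ i, b i • ⟨_, hrow i⟩ := by
      ext1
      simp [planeWord]
    rw [this, map_sum, Fin.sum_univ_four]
    simp only [map_smul, smul_eq_mul, q]
  have hpoint : ∀ P : F × F, P.2 ^ 2 = P.1 ^ 3 - ε ^ 3 → ∃ j, shortCoord W (e j) = some P := by
    intro P hP
    rw [hεc] at hP
    obtain ⟨R, hR⟩ := exists_shortCoord_eq h2 h3 hc hP
    exact ⟨e.symm R, by simpa using hR⟩
  have hzeros : ∀ (b : Fin 4 → F) (S : Finset (Option (F × F))), planeWord W e b ≠ 0 →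
      b 0 * q 0 + b 1 * q 1 + b 2 * q 2 + b 3 * q 3 = 0 →
      (∀ o ∈ S, ∃ j, shortCoord W (e j) = o ∧ planeWord W e b j = 0) → S.card < 4 := by
    intro b S hb hbq hS
    have hnorm := hQ ⟨_, hword b⟩ (fun h => hb (congrArg Subtype.val h)) ((hQword b).trans hbq)
    have hsum := hammingNorm_add_card_zeros (planeWord W e b)
    have hle : S.card ≤ (Finset.univ.filter fun j => planeWord W e b j = 0).card := by
      refine (Finset.card_le_card fun o ho => ?_).trans
        (Finset.card_image_le (f := fun j => shortCoord W (e j)))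
      obtain ⟨j, hj, hj0⟩ := hS o ho
      exact Finset.mem_image.2 ⟨j, by simpa using hj0, hj⟩
    simp only at hnorm
    omega
  obtain ⟨j₀, hj₀⟩ := exists_shortCoord_eq_none W e
  refine ⟨q 0, q 1, q 2, q 3, ?_, ?_⟩
  · intro a₀ a₁ a₂ hrel l hl hP
    have := hzeros ![a₀, a₁, a₂, 1] (l.toFinset.map Function.Embedding.some) (fun h => by
      have := congrFun h j₀
      rw [planeWord_eq_of_none hj₀] at this
      simp at this) (by simpa using hrel) (fun o ho => by
        obtain ⟨P, hPl, rfl⟩ := Finset.mem_map.1 ho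
        obtain ⟨h1, h2⟩ := hP P (List.mem_toFinset.1 hPl)
        obtain ⟨j, hj⟩ := hpoint P h1
        refine ⟨j, hj, ?_⟩
        rw [planeWord_eq_of_some hj]
        simpa using h2)
    rwa [Finset.card_map, List.toFinset_card_of_nodup hl] at this
  · intro a₀ a₁ ha₁ hrel l hl hP
    have := hzeros ![a₀, a₁, 1, 0] l.toFinset.insertNone (fun h => by
      obtain ⟨j, hj⟩ := hpoint (ε, 0) (by ring)
      obtain ⟨k, hk⟩ := hpoint (ω * ε, 0) (by linear_combination -ε ^ 3 * hω3)
      have hj' := congrFun h j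
      have hk' := congrFun h k
      rw [planeWord_eq_of_some hj] at hj'
      rw [planeWord_eq_of_some hk] at hk'
      simp at hj' hk'
      exact mul_ne_zero (mul_ne_zero ha₁ hε) (sub_ne_zero.2 hω1)
        (by linear_combination hk' - hj')) (by simpa using hrel) (fun o ho => by
        cases o with
        | none => exact ⟨j₀, hj₀, by rw [planeWord_eq_of_none hj₀]; simp⟩
        | some P =>
          obtain ⟨h1, h2⟩ := hP P (by simpa using ho)
          obtain ⟨j, hj⟩ := hpoint P h1
          refine ⟨j, hj, ?_⟩
          rw [planeWord_eq_of_some hj]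
          simpa using h2)
    rw [Finset.card_insertNone, List.toFinset_card_of_nodup hl] at this
    omega

lemma exists_shortCoord_eq_zero (h2 : (2 : F) ≠ 0) {W : WeierstrassCurve F}
    [Finite W.toAffine.Point] (heven : Even (Nat.card W.toAffine.Point)) :
    ∃ (P : W.toAffine.Point) (ε : F), shortCoord W P = some (ε, 0) := by
  obtain ⟨P, hP⟩ := exists_prime_addOrderOf_dvd_card' 2 heven.two_dvd
  have hP0 : P ≠ 0 := by rintro rfl; simp at hP
  have hneg : P = -P := by
    have := addOrderOf_nsmul_eq_zero P
    rw [hP, two_nsmul] at this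
    exact eq_neg_of_add_eq_zero_left this
  cases P with
  | zero => exact absurd rfl hP0
  | some x y h =>
    refine ⟨.some x y h, x + W.b₂ / 12, ?_⟩
    rw [Affine.Point.neg_some] at hneg
    have hy : y = W.toAffine.negY x y := by simpa using hneg
    rw [Affine.negY] at hy
    simp only [shortCoord, Option.some.injEq, Prod.mk.injEq, true_and]
    field_simp
    linear_combination hy

lemma exists_primitive_cube_root (h : Fintype.card F % 3 = 1) : ∃ ω : F, ω ^ 2 + ω + 1 = 0 := by
  have : Fact (Nat.Prime 3) := ⟨Nat.prime_three⟩
  obtain ⟨g, hg⟩ := exists_prime_orderOf_dvd_card (G := Fˣ) 3 (by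
    rw [Fintype.card_units]; omega)
  have h1 : (g : F) ≠ 1 := by
    intro h
    rw [Units.val_eq_one.1 h, orderOf_one] at hg
    omega
  have h3 : (g : F) ^ 3 = 1 := by
    rw [← hg, ← Units.val_pow_eq_pow_val, pow_orderOf_eq_one, Units.val_one]
  exact ⟨g, mul_left_cancel₀ (sub_ne_zero.2 h1) (by linear_combination h3)⟩

lemma ringChar_eq_of_card {p r : ℕ} (hp : p.Prime) (hcard : Fintype.card F = p ^ r) :
    ringChar F = p := by
  obtain ⟨m, hprime, hm⟩ := FiniteField.card F (ringChar F)
  refine (Nat.prime_dvd_prime_iff_eq hprime hp).1 (hprime.dvd_of_dvd_pow (n := r) ?_)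
  rw [← hcard, hm]
  exact dvd_pow_self _ m.ne_zero

end

/-- Let `q = p^r`, `p > 3` prime, `q > 9887`, and `E/F_q` elliptic with
`j(E) = 0` and an even number of rational points. If `r` is even or `p ≡ 1 (mod 3)`, then
the `4`-elliptic code associated to `E` is not `2`-extendable. -/
theorem statement16 (p r : ℕ) (hp : p.Prime) (hp3 : 3 < p)
    (hcard : Fintype.card F = p ^ r) (hq : 9887 < Fintype.card F)
    (W : WeierstrassCurve F) [W.IsElliptic] (hj : W.j = 0)
    (heven : Even (Nat.card W.toAffine.Point))
    (hcase : Even r ∨ p % 3 = 1) {n : ℕ}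
    (hn : n = Nat.card W.toAffine.Point) (e : Fin n ≃ W.toAffine.Point) :
    ¬ IsHExtendable 2 (ellipticCode W 4 e) := by
  intro hext
  have hchar : ringChar F = p := ringChar_eq_of_card hp hcard
  have hsmall : ∀ m : ℕ, 0 < m → m < 4 → (m : F) ≠ 0 := by
    intro m hm hm4 h
    have := Nat.le_of_dvd hm ((ringChar.spec F m).1 h)
    omega
  have h2 : (2 : F) ≠ 0 := by exact_mod_cast hsmall 2 (by norm_num) (by norm_num)
  have h3 : (3 : F) ≠ 0 := by exact_mod_cast hsmall 3 (by norm_num) (by norm_num)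
  have hmod : Fintype.card F % 3 = 1 := by
    rw [hcard]
    rcases hcase with ⟨s, rfl⟩ | h
    · have hp' : p % 3 = 1 ∨ p % 3 = 2 := by
        have : ¬ 3 ∣ p := fun h => by
          have := (Nat.prime_dvd_prime_iff_eq Nat.prime_three hp).1 h
          omega
        omega
      rw [← two_mul, pow_mul, Nat.pow_mod]
      have : p ^ 2 % 3 = 1 := by
        rw [Nat.pow_mod]
        rcases hp' with h | h <;> simp [h]
      simp [this]
    · simp [Nat.pow_mod, h]
  obtain ⟨ω, hω⟩ := exists_primitive_cube_root hmod
  have hc : W.c₄ = 0 := W.j_eq_zero_iff.1 hj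
  have : Finite W.toAffine.Point := Finite.of_equiv _ e
  obtain ⟨P, ε, hP⟩ := exists_shortCoord_eq_zero h2 heven
  have hεc : ε ^ 3 = W.c₆ / 864 := by linear_combination -shortCoord_eq_some h2 h3 hc hP
  have hε : ε ≠ 0 := by
    rintro rfl
    have h864 : (864 : F) ≠ 0 := by
      rw [show (864 : F) = 2 ^ 5 * 3 ^ 3 by norm_num]
      exact mul_ne_zero (pow_ne_zero _ h2) (pow_ne_zero _ h3)
    have hc6 : W.c₆ = 0 := by
      field_simp at hεc
      simpa using hεc.symm
    have hΔ := W.c_relation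
    rw [hc, hc6] at hΔ
    refine mul_ne_zero (mul_ne_zero h2 h864) W.isUnit_Δ.ne_zero ?_
    linear_combination hΔ
  obtain ⟨q₀, q₁, q₂, q₃, h⟩ := exists_noFourSecant_of_isHExtendable h2 h3 hω hc hε hεc hext
  exact not_noFourSecant (by omega) h3 hq hω hε h

end NMDS
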